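/- arXiv:math/0012206 — 2 statements merged into one kernel-verified Lean document; each statement's English description precedes it below -/
import Mathlib

section
/- Let (R_1,…,R_s) and (T_1,…,T_t) be weak hinges on an n-dimensional complex vector space V. Then each product T_i R_j over a transversal pair (T_i, R_j) satisfies dim(T_i R_j) = n, and the collection of all such products can be enumerated as S_1,…,S_r in such a way that (S_1,…,S_r) is a weak hinge. -/
open Module

noncomputable section

variable {V W Y Z : Type*}
  [AddCommGroup V] [Module ℂ V] [AddCommGroup W] [Module ℂ W]
  [AddCommGroup Y] [Module ℂ Y] [AddCommGroup Z] [Module ℂ Z]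

/-- The kernel of a linear relation `P : V ⇉ W`. -/
def relKer (P : Submodule ℂ (V × W)) : Submodule ℂ V :=
  P.comap (LinearMap.inl ℂ V W)

/-- The indefiniteness of a linear relation `P : V ⇉ W`. -/
def relIndef (P : Submodule ℂ (V × W)) : Submodule ℂ W :=
  P.comap (LinearMap.inr ℂ V W)

/-- The domain of a linear relation `P : V ⇉ W`. -/
def relDom (P : Submodule ℂ (V × W)) : Submodule ℂ V :=
  P.map (LinearMap.fst ℂ V W)

/-- The image of a linear relation `P : V ⇉ W`. -/
def relIm (P : Submodule ℂ (V × W)) : Submodule ℂ W :=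
  P.map (LinearMap.snd ℂ V W)

/-- The product `QP` of two linear relations. -/
def relComp (Q : Submodule ℂ (W × Y)) (P : Submodule ℂ (V × W)) : Submodule ℂ (V × Y) where
  carrier := {p | ∃ w : W, (p.1, w) ∈ P ∧ (w, p.2) ∈ Q}
  add_mem' := by
    rintro ⟨a, b⟩ ⟨c, d⟩ ⟨w₁, h₁, h₂⟩ ⟨w₂, h₃, h₄⟩
    exact ⟨w₁ + w₂, P.add_mem h₁ h₃, Q.add_mem h₂ h₄⟩
  zero_mem' := ⟨0, P.zero_mem, Q.zero_mem⟩
  smul_mem' := by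
    rintro c ⟨a, b⟩ ⟨w, h₁, h₂⟩
    exact ⟨c • w, P.smul_mem c h₁, Q.smul_mem c h₂⟩

/-- The pair `(Q, P)` of linear relations is transversal. -/
def Transversal (Q : Submodule ℂ (W × Y)) (P : Submodule ℂ (V × W)) : Prop :=
  relIm P ⊔ relDom Q = ⊤ ∧ relIndef P ⊓ relKer Q = ⊥

end

/-- `(R 0, …, R (s-1))` is a weak hinge on `V`: each `R j` is a linear relation `V ⇉ V` of
dimension `dim V`, and `Ker R_j ⊇ Dom R_{j+1}`, `Im R_j ⊆ Indef R_{j+1}` for consecutive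
terms. -/
structure IsWeakHinge {V : Type*} [AddCommGroup V] [Module ℂ V]
    {s : ℕ} (R : Fin s → Submodule ℂ (V × V)) : Prop where
  dim_eq : ∀ j, Module.finrank ℂ (R j) = Module.finrank ℂ V
  dom_le_ker : ∀ (j : ℕ) (h : j + 1 < s), relDom (R ⟨j + 1, h⟩) ≤ relKer (R ⟨j, by omega⟩)
  im_le_indef : ∀ (j : ℕ) (h : j + 1 < s), relIm (R ⟨j, by omega⟩) ≤ relIndef (R ⟨j + 1, h⟩)

section LinearRelation

variable {V W Y : Type*}
  [AddCommGroup V] [Module ℂ V] [AddCommGroup W] [Module ℂ W] [AddCommGroup Y] [Module ℂ Y]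

lemma mem_relDom {P : Submodule ℂ (V × W)} {v : V} : v ∈ relDom P ↔ ∃ w, (v, w) ∈ P := by
  simp [relDom]

lemma mem_relIm {P : Submodule ℂ (V × W)} {w : W} : w ∈ relIm P ↔ ∃ v, (v, w) ∈ P := by
  simp [relIm]

lemma relKer_le_relDom (P : Submodule ℂ (V × W)) : relKer P ≤ relDom P :=
  fun _ hv => mem_relDom.2 ⟨0, hv⟩

lemma relIndef_le_relIm (P : Submodule ℂ (V × W)) : relIndef P ≤ relIm P :=
  fun _ hw => mem_relIm.2 ⟨0, hw⟩

lemma relDom_relComp_le (Q : Submodule ℂ (W × Y)) (P : Submodule ℂ (V × W)) :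
    relDom (relComp Q P) ≤ relDom P := by
  intro v hv
  obtain ⟨y, w, hP, -⟩ := mem_relDom.1 hv
  exact mem_relDom.2 ⟨w, hP⟩

lemma relIm_relComp_le (Q : Submodule ℂ (W × Y)) (P : Submodule ℂ (V × W)) :
    relIm (relComp Q P) ≤ relIm Q := by
  intro y hy
  obtain ⟨v, w, -, hQ⟩ := mem_relIm.1 hy
  exact mem_relIm.2 ⟨w, hQ⟩

lemma relKer_le_relKer_relComp (Q : Submodule ℂ (W × Y)) (P : Submodule ℂ (V × W)) :
    relKer P ≤ relKer (relComp Q P) :=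
  fun _ hv => ⟨0, hv, Q.zero_mem⟩

lemma relIndef_le_relIndef_relComp (Q : Submodule ℂ (W × Y)) (P : Submodule ℂ (V × W)) :
    relIndef Q ≤ relIndef (relComp Q P) :=
  fun _ hy => ⟨0, P.zero_mem, hy⟩

/-- If `Dom Q' ⊆ Ker Q` then `Dom (Q'P) ⊆ Ker (QP)`. -/
lemma relDom_relComp_le_relKer_relComp {Q Q' : Submodule ℂ (W × Y)}
    (h : relDom Q' ≤ relKer Q) (P : Submodule ℂ (V × W)) :
    relDom (relComp Q' P) ≤ relKer (relComp Q P) := by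
  intro v hv
  obtain ⟨y, w, hP, hQ⟩ := mem_relDom.1 hv
  exact ⟨w, hP, h (mem_relDom.2 ⟨y, hQ⟩)⟩

/-- If `Im P ⊆ Indef P'` then `Im (QP) ⊆ Indef (QP')`. -/
lemma relIm_relComp_le_relIndef_relComp {P P' : Submodule ℂ (V × W)}
    (h : relIm P ≤ relIndef P') (Q : Submodule ℂ (W × Y)) :
    relIm (relComp Q P) ≤ relIndef (relComp Q P') := by
  intro y hy
  obtain ⟨v, w, hP, hQ⟩ := mem_relIm.1 hy
  exact ⟨w, h (mem_relIm.2 ⟨v, hP⟩), hQ⟩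

lemma relDom_relComp_le_relKer_of_disjoint {Q : Submodule ℂ (W × Y)} {P : Submodule ℂ (V × W)}
    (h : relIm P ⊓ relDom Q = ⊥) : relDom (relComp Q P) ≤ relKer P := by
  intro v hv
  obtain ⟨y, w, hP, hQ⟩ := mem_relDom.1 hv
  have hw : w ∈ relIm P ⊓ relDom Q := ⟨mem_relIm.2 ⟨v, hP⟩, mem_relDom.2 ⟨y, hQ⟩⟩
  rw [h, Submodule.mem_bot] at hw
  subst hw
  exact hP

lemma relDom_le_relKer_relComp_of_sup_eq_top {Q : Submodule ℂ (W × Y)}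
    {P : Submodule ℂ (V × W)} (h : relIndef P ⊔ relKer Q = ⊤) :
    relDom P ≤ relKer (relComp Q P) := by
  intro v hv
  obtain ⟨w, hP⟩ := mem_relDom.1 hv
  obtain ⟨a, ha, k, hk, rfl⟩ := Submodule.mem_sup.1 (h ▸ Submodule.mem_top : w ∈ _)
  refine ⟨k, ?_, hk⟩
  simpa using P.sub_mem hP ha

lemma finrank_relKer_add_finrank_relIm [FiniteDimensional ℂ V] [FiniteDimensional ℂ W]
    (P : Submodule ℂ (V × W)) :
    finrank ℂ (relKer P) + finrank ℂ (relIm P) = finrank ℂ P := by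
  have h := ((LinearMap.snd ℂ V W).domRestrict P).finrank_range_add_finrank_ker
  rw [LinearMap.range_domRestrict] at h
  have e : finrank ℂ (relKer P) = finrank ℂ ((LinearMap.snd ℂ V W).domRestrict P).ker := by
    refine LinearEquiv.finrank_eq (LinearEquiv.ofBijective
      (LinearMap.codRestrict _
        (LinearMap.codRestrict P ((LinearMap.inl ℂ V W).domRestrict (relKer P)) fun v => v.2)
        fun v => rfl) ⟨?_, ?_⟩)
    · exact fun v w hvw => Subtype.ext (congrArg (fun x => x.1.1.1) hvw)
    · rintro ⟨⟨⟨v, w⟩, hP⟩, rfl : w = 0⟩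
      exact ⟨⟨v, hP⟩, rfl⟩
  rw [e, add_comm]
  exact h

lemma finrank_relDom_add_finrank_relIndef [FiniteDimensional ℂ V] [FiniteDimensional ℂ W]
    (P : Submodule ℂ (V × W)) :
    finrank ℂ (relDom P) + finrank ℂ (relIndef P) = finrank ℂ P := by
  have h := ((LinearMap.fst ℂ V W).domRestrict P).finrank_range_add_finrank_ker
  rw [LinearMap.range_domRestrict] at h
  have e : finrank ℂ (relIndef P) = finrank ℂ ((LinearMap.fst ℂ V W).domRestrict P).ker := by
    refine LinearEquiv.finrank_eq (LinearEquiv.ofBijective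
      (LinearMap.codRestrict _
        (LinearMap.codRestrict P ((LinearMap.inr ℂ V W).domRestrict (relIndef P)) fun v => v.2)
        fun v => rfl) ⟨?_, ?_⟩)
    · exact fun v w hvw => Subtype.ext (congrArg (fun x => x.1.1.2) hvw)
    · rintro ⟨⟨⟨v, w⟩, hP⟩, rfl : v = 0⟩
      exact ⟨⟨w, hP⟩, rfl⟩
  rw [e]
  exact h

/-- `dim (QP) = dim Q + dim P - dim W` for a transversal pair `(Q, P)`. -/
lemma Transversal.finrank_relComp_add [FiniteDimensional ℂ V] [FiniteDimensional ℂ W]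
    [FiniteDimensional ℂ Y] {Q : Submodule ℂ (W × Y)} {P : Submodule ℂ (V × W)}
    (h : Transversal Q P) :
    finrank ℂ (relComp Q P) + finrank ℂ W = finrank ℂ P + finrank ℂ Q := by
  let f : P × Q →ₗ[ℂ] W := ((LinearMap.snd ℂ V W).domRestrict P).coprod
    (-(LinearMap.fst ℂ W Y).domRestrict Q)
  have hf (x : P × Q) : f x = x.1.1.2 - x.2.1.1 := by simp [f, sub_eq_add_neg]
  let g : f.ker →ₗ[ℂ] V × Y :=
    (((LinearMap.fst ℂ V W).domRestrict P).prodMap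
      ((LinearMap.snd ℂ W Y).domRestrict Q)).domRestrict f.ker
  have hf_surj : f.range = ⊤ := by
    refine LinearMap.range_eq_top.2 fun z => ?_
    obtain ⟨a, ha, b, hb, rfl⟩ := Submodule.mem_sup.1 (h.1 ▸ Submodule.mem_top : z ∈ _)
    obtain ⟨v, hv⟩ := mem_relIm.1 ha
    obtain ⟨y, hy⟩ := mem_relDom.1 hb
    exact ⟨(⟨_, hv⟩, -⟨_, hy⟩), by simp [hf]⟩
  have hg_inj : Function.Injective g := by
    rintro ⟨⟨⟨⟨v₁, w₁⟩, hP₁⟩, ⟨⟨w₁', y₁⟩, hQ₁⟩⟩, hx₁⟩ ⟨⟨⟨⟨v₂, w₂⟩, hP₂⟩, ⟨⟨w₂', y₂⟩, hQ₂⟩⟩, hx₂⟩ hz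
    obtain rfl : w₁ = w₁' := by simpa [hf, sub_eq_zero] using hx₁
    obtain rfl : w₂ = w₂' := by simpa [hf, sub_eq_zero] using hx₂
    obtain ⟨rfl, rfl⟩ : v₁ = v₂ ∧ y₁ = y₂ := by simpa [g] using hz
    have hw : w₁ - w₂ ∈ relIndef P ⊓ relKer Q :=
      ⟨by simpa [relIndef] using P.sub_mem hP₁ hP₂, by simpa [relKer] using Q.sub_mem hQ₁ hQ₂⟩
    rw [h.2, Submodule.mem_bot, sub_eq_zero] at hw
    subst hw
    rfl
  have hg_range : g.range = relComp Q P := by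
    ext ⟨v, y⟩
    constructor
    · rintro ⟨⟨⟨⟨⟨v', w⟩, hP⟩, ⟨⟨w', y'⟩, hQ⟩⟩, hx⟩, hz⟩
      obtain rfl : w = w' := by simpa [hf, sub_eq_zero] using hx
      obtain ⟨rfl, rfl⟩ : v' = v ∧ y' = y := by simpa [g] using hz
      exact ⟨w, hP, hQ⟩
    · rintro ⟨w, hP, hQ⟩
      exact ⟨⟨(⟨(v, w), hP⟩, ⟨(w, y), hQ⟩), by simp [hf]⟩, rfl⟩
  have h₁ := f.finrank_range_add_finrank_ker
  have h₂ := LinearMap.finrank_range_of_inj hg_inj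
  rw [hf_surj, finrank_top, Module.finrank_prod] at h₁
  rw [hg_range] at h₂
  omega

end LinearRelation

section WeakHinge

variable {V : Type*} [AddCommGroup V] [Module ℂ V] {s t : ℕ}
  {R : Fin s → Submodule ℂ (V × V)} {T : Fin t → Submodule ℂ (V × V)}

lemma IsWeakHinge.relDom_le_relKer_and_relIm_le_relIndef (hR : IsWeakHinge R) {i j : Fin s}
    (hij : i < j) : relDom (R j) ≤ relKer (R i) ∧ relIm (R i) ≤ relIndef (R j) := by
  obtain ⟨i, hi⟩ := i
  obtain ⟨j, hj⟩ := j
  replace hij : i + 1 ≤ j := hij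
  induction j, hij using Nat.le_induction with
  | base => exact ⟨hR.dom_le_ker i hj, hR.im_le_indef i hj⟩
  | succ j _ ih =>
    obtain ⟨h₁, h₂⟩ := ih (by omega)
    exact ⟨(hR.dom_le_ker j hj).trans ((relKer_le_relDom _).trans h₁),
      h₂.trans ((relIndef_le_relIm _).trans (hR.im_le_indef j hj))⟩

lemma IsWeakHinge.relDom_le_relKer (hR : IsWeakHinge R) {i j : Fin s} (hij : i < j) :
    relDom (R j) ≤ relKer (R i) :=
  (hR.relDom_le_relKer_and_relIm_le_relIndef hij).1

lemma IsWeakHinge.relIm_le_relIndef (hR : IsWeakHinge R) {i j : Fin s} (hij : i < j) :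
    relIm (R i) ≤ relIndef (R j) :=
  (hR.relDom_le_relKer_and_relIm_le_relIndef hij).2

lemma IsWeakHinge.finrank_relComp [FiniteDimensional ℂ V] (hR : IsWeakHinge R)
    (hT : IsWeakHinge T) {i : Fin t} {j : Fin s} (h : Transversal (T i) (R j)) :
    finrank ℂ (relComp (T i) (R j)) = finrank ℂ V := by
  have := h.finrank_relComp_add
  rw [hR.dim_eq, hT.dim_eq] at this
  omega

/-- If two transversal pairs have oppositely ordered indices, then the domain of one product lies
in the kernel of the other (in fact both products equal `Ker R_{j'} ⊕ Indef T_{i'}`). -/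
lemma IsWeakHinge.relDom_relComp_le_relKer_of_lt_of_gt [FiniteDimensional ℂ V] (hR : IsWeakHinge R)
    (hT : IsWeakHinge T) {i i' : Fin t} {j j' : Fin s} (h : Transversal (T i) (R j))
    (h' : Transversal (T i') (R j')) (hi : i < i') (hj : j' < j) :
    relDom (relComp (T i') (R j')) ≤ relKer (relComp (T i) (R j)) := by
  have hT_le := hT.relDom_le_relKer hi
  have hR_le := hR.relIm_le_relIndef hj
  have h_inf : relIm (R j') ⊓ relDom (T i') = ⊥ :=
    le_bot_iff.1 ((inf_le_inf hR_le hT_le).trans h.2.le)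
  have h_sup : relIndef (R j) ⊔ relKer (T i) = ⊤ :=
    top_le_iff.1 (h'.1.ge.trans (sup_le_sup hR_le hT_le))
  have h_im : relIm (R j') = relIndef (R j) :=
    eq_of_le_of_inf_le_of_sup_le (z := relKer (T i)) hR_le (h.2.le.trans bot_le)
      (le_top.trans (h'.1.ge.trans (sup_le_sup_left hT_le _)))
  have h_ker : relDom (R j) = relKer (R j') := by
    refine Submodule.eq_of_le_of_finrank_eq (hR.relDom_le_relKer hj) ?_
    have h₁ := finrank_relKer_add_finrank_relIm (R j')
    have h₂ := finrank_relDom_add_finrank_relIndef (R j)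
    rw [hR.dim_eq] at h₁ h₂
    rw [h_im] at h₁
    omega
  calc relDom (relComp (T i') (R j')) ≤ relKer (R j') := relDom_relComp_le_relKer_of_disjoint h_inf
    _ = relDom (R j) := h_ker.symm
    _ ≤ relKer (relComp (T i) (R j)) := relDom_le_relKer_relComp_of_sup_eq_top h_sup

lemma IsWeakHinge.relDom_relComp_le_relKer_of_toLex_lt [FiniteDimensional ℂ V] (hR : IsWeakHinge R)
    (hT : IsWeakHinge T) {i i' : Fin t} {j j' : Fin s} (h : Transversal (T i) (R j))
    (h' : Transversal (T i') (R j')) (hlt : toLex (i, j) < toLex (i', j')) :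
    relDom (relComp (T i') (R j')) ≤ relKer (relComp (T i) (R j)) := by
  rcases lt_trichotomy j j' with hj | rfl | hj
  · exact (relDom_relComp_le _ _).trans
      ((hR.relDom_le_relKer hj).trans (relKer_le_relKer_relComp _ _))
  · have hi : i < i' := by simpa [Prod.Lex.toLex_lt_toLex] using hlt
    exact relDom_relComp_le_relKer_relComp (hT.relDom_le_relKer hi) _
  · have hi : i < i' := by simpa [Prod.Lex.toLex_lt_toLex, hj.not_gt] using hlt
    exact hR.relDom_relComp_le_relKer_of_lt_of_gt hT h h' hi hj

lemma IsWeakHinge.relIm_relComp_le_relIndef_of_toLex_lt (hR : IsWeakHinge R)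
    (hT : IsWeakHinge T) {i i' : Fin t} {j j' : Fin s}
    (hlt : toLex (i, j) < toLex (i', j')) :
    relIm (relComp (T i) (R j)) ≤ relIndef (relComp (T i') (R j')) := by
  rcases Prod.Lex.toLex_lt_toLex.1 hlt with hi | ⟨hi, hj⟩
  · exact (relIm_relComp_le _ _).trans
      ((hT.relIm_le_relIndef hi).trans (relIndef_le_relIndef_relComp _ _))
  · obtain rfl : i = i' := hi
    exact relIm_relComp_le_relIndef_relComp (hR.relIm_le_relIndef hj) _

end WeakHinge

theorem weakHinge_products_form_weakHinge
    {V : Type*} [AddCommGroup V] [Module ℂ V] [FiniteDimensional ℂ V]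
    {n s t : ℕ} (hn : finrank ℂ V = n)
    (R : Fin s → Submodule ℂ (V × V)) (hR : IsWeakHinge R)
    (T : Fin t → Submodule ℂ (V × V)) (hT : IsWeakHinge T) :
    (∀ (i : Fin t) (j : Fin s), Transversal (T i) (R j) →
      finrank ℂ (relComp (T i) (R j)) = n) ∧
    ∃ (r : ℕ) (S : Fin r → Submodule ℂ (V × V))
      (e : {p : Fin t × Fin s // Transversal (T p.1) (R p.2)} ≃ Fin r),
      IsWeakHinge S ∧ ∀ p, S (e p) = relComp (T p.1.1) (R p.1.2) := by
  classical
  subst hn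
  refine ⟨fun i j h => hR.finrank_relComp hT h, ?_⟩
  let A := {x : Fin t ×ₗ Fin s // Transversal (T (ofLex x).1) (R (ofLex x).2)}
  let o : Fin (Fintype.card A) ≃o A := Fintype.orderIsoFinOfCardEq A rfl
  let e : {p : Fin t × Fin s // Transversal (T p.1) (R p.2)} ≃ A :=
    toLex.subtypeEquiv fun _ => Iff.rfl
  have ho (j : ℕ) (h : j + 1 < Fintype.card A) : (o ⟨j, by omega⟩).1 < (o ⟨j + 1, h⟩).1 :=
    o.strictMono (Fin.mk_lt_mk.2 j.lt_succ_self)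
  refine ⟨Fintype.card A, fun k => relComp (T (ofLex (o k).1).1) (R (ofLex (o k).1).2),
    e.trans o.symm.toEquiv, ⟨fun k => hR.finrank_relComp hT (o k).2, fun j h => ?_,
      fun j h => ?_⟩, fun p => ?_⟩
  · exact hR.relDom_relComp_le_relKer_of_toLex_lt hT (o _).2 (o _).2 (ho j h)
  · exact hR.relIm_relComp_le_relIndef_of_toLex_lt hT (ho j h)
  · simp only [Equiv.trans_apply, OrderIso.coe_toEquiv, OrderIso.apply_symm_apply]
    rfl
end

section
/- Let T = (T_1,…,T_t) and R = (R_1,…,R_s) be weak hinges on an n-dimensional complex vector space V, and let TR denote the product weak hinge formed by the products T_i R_j over transversal pairs. Then for every m ∈ {0,…,n} there exists a nonzero constant c ∈ ℂ such that λ^m(T) ∘ λ^m(R) = c·λ^m(TR). -/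
open Module

noncomputable section

variable {V W : Type*} [AddCommGroup V] [Module ℂ V] [AddCommGroup W] [Module ℂ W]

/-- A canonical basis pair for a linear relation `S : V ⇉ W`: a basis
`f₁,…,f_α, g₁,…,g_β, h₁,…,h_γ` of `V` and a basis `F₁,…,F_μ, G₁,…,G_β, H₁,…,H_ν` of `W`
such that `S` is spanned by the vectors `(0,Fᵢ)`, `(gⱼ,Gⱼ)`, `(hₗ,0)`. -/
structure CanonicalBasisPair (S : Submodule ℂ (V × W)) where
  α : ℕ
  β : ℕ
  γ : ℕ
  μ : ℕ
  ν : ℕ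
  bV : Basis (Fin α ⊕ Fin β ⊕ Fin γ) ℂ V
  bW : Basis (Fin μ ⊕ Fin β ⊕ Fin ν) ℂ W
  hspan : S = Submodule.span ℂ
      (Set.range (fun i : Fin μ => ((0 : V), bW (Sum.inl i))) ∪
       Set.range (fun j : Fin β => (bV (Sum.inr (Sum.inl j)), bW (Sum.inr (Sum.inl j)))) ∪
       Set.range (fun l : Fin γ => (bV (Sum.inr (Sum.inr l)), (0 : W))))

end

noncomputable section

variable {V W : Type*} [AddCommGroup V] [Module ℂ V] [AddCommGroup W] [Module ℂ W]

/-- The tuple `f₁, …, f_α, g_{i₁}, …, g_{i_s}` (with `i₁ < … < i_s` the elements of `s`)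
in `V`, associated with a canonical basis pair. -/
def goodTupleV {S : Submodule ℂ (V × W)} (c : CanonicalBasisPair S)
    (s : Finset (Fin c.β)) : Fin (c.α + s.card) → V :=
  Fin.addCases (fun i => c.bV (Sum.inl i))
    (fun j => c.bV (Sum.inr (Sum.inl ((s.orderIsoOfFin rfl j : s) : Fin c.β))))

/-- The tuple `F₁, …, F_μ, G_{i₁}, …, G_{i_s}` (with `i₁ < … < i_s` the elements of `s`)
in `W`, associated with a canonical basis pair. -/
def goodTupleW {S : Submodule ℂ (V × W)} (c : CanonicalBasisPair S)
    (s : Finset (Fin c.β)) : Fin (c.μ + s.card) → W :=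
  Fin.addCases (fun i => c.bW (Sum.inl i))
    (fun j => c.bW (Sum.inr (Sum.inl ((s.orderIsoOfFin rfl j : s) : Fin c.β))))

/-- `L : Λ(V) → Λ(W)` is the operator `λ(S)` obtained from the canonical basis pair `c` for `S`:
it sends each basis monomial `f₁∧…∧f_α∧g_{i₁}∧…∧g_{i_s}` to `F₁∧…∧F_μ∧G_{i₁}∧…∧G_{i_s}` and
every other monomial in the chosen basis of `V` (i.e. every monomial of basis vectors that
misses some `f` or contains some `h`) to `0`. -/
def IsLambda {S : Submodule ℂ (V × W)} (c : CanonicalBasisPair S)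
    (L : ExteriorAlgebra ℂ V →ₗ[ℂ] ExteriorAlgebra ℂ W) : Prop :=
  (∀ s : Finset (Fin c.β),
      L (ExteriorAlgebra.ιMulti ℂ _ (goodTupleV c s)) =
        ExteriorAlgebra.ιMulti ℂ _ (goodTupleW c s)) ∧
  (∀ (k : ℕ) (x : Fin k → (Fin c.α ⊕ Fin c.β ⊕ Fin c.γ)),
      ((∃ i : Fin c.α, Sum.inl i ∉ Set.range x) ∨
        (∃ l : Fin c.γ, Sum.inr (Sum.inr l) ∈ Set.range x)) →
      L (ExteriorAlgebra.ιMulti ℂ k (fun i => c.bV (x i))) = 0)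

end

noncomputable section

variable {V W : Type*} [AddCommGroup V] [Module ℂ V] [AddCommGroup W] [Module ℂ W]

/-- The wedge product `x₁ ∧ … ∧ x_m` as an element of the `m`-th exterior power. -/
def ιMultiP (m : ℕ) (x : Fin m → V) : ⋀[ℂ]^m V :=
  ⟨ExteriorAlgebra.ιMulti ℂ m x, ExteriorAlgebra.ιMulti_range ℂ m (Set.mem_range_self x)⟩

/-- `L : Λ^m V → Λ^m W` is the degree-`m` component `λ^m(S)` of the operator obtained from the
canonical basis pair `c` for `S`: it sends each degree-`m` basis monomial
`f₁∧…∧f_α∧g_{i₁}∧…∧g_{i_s}` to `F₁∧…∧F_μ∧G_{i₁}∧…∧G_{i_s}` and every other degree-`m`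
monomial in the chosen basis of `V` to `0`. -/
def IsLambdaM {S : Submodule ℂ (V × W)} (c : CanonicalBasisPair S) (m : ℕ)
    (L : (⋀[ℂ]^m V) →ₗ[ℂ] (⋀[ℂ]^m W)) : Prop :=
  (∀ (s : Finset (Fin c.β)) (h1 : c.α + s.card = m) (h2 : c.μ + s.card = m),
      L (ιMultiP m (goodTupleV c s ∘ Fin.cast h1.symm)) =
        ιMultiP m (goodTupleW c s ∘ Fin.cast h2.symm)) ∧
  (∀ x : Fin m → (Fin c.α ⊕ Fin c.β ⊕ Fin c.γ),
      ((∃ i : Fin c.α, Sum.inl i ∉ Set.range x) ∨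
        (∃ l : Fin c.γ, Sum.inr (Sum.inr l) ∈ Set.range x)) →
      L (ιMultiP m fun i => c.bV (x i)) = 0)

end

/-- `L` is the operator `λ^m(R)` of a weak hinge `R = (R_1,…,R_s)`: it equals (a choice of)
`λ^m(R_j)` for some `j` with `λ^m(R_j) ≠ 0` if such a `j` exists, and `0` otherwise. -/
def IsLambdaWeak {V : Type*} [AddCommGroup V] [Module ℂ V]
    {s : ℕ} (R : Fin s → Submodule ℂ (V × V)) (m : ℕ)
    (L : (⋀[ℂ]^m V) →ₗ[ℂ] (⋀[ℂ]^m V)) : Prop :=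
  (∃ (j : Fin s) (c : CanonicalBasisPair (R j)), IsLambdaM c m L ∧ L ≠ 0) ∨
  ((∀ (j : Fin s) (c : CanonicalBasisPair (R j)) (L' : (⋀[ℂ]^m V) →ₗ[ℂ] (⋀[ℂ]^m V)),
      IsLambdaM c m L' → L' = 0) ∧ L = 0)

namespace LinearRelation

noncomputable section

variable {V W Y : Type*} [AddCommGroup V] [Module ℂ V] [AddCommGroup W] [Module ℂ W]
  [AddCommGroup Y] [Module ℂ Y]

open ExteriorAlgebra (ι)

/-- The interior product of an exterior form with a covector. -/
def contract (φ : Dual ℂ V) : ExteriorAlgebra ℂ V →ₗ[ℂ] ExteriorAlgebra ℂ V :=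
  CliffordAlgebra.contractLeft (Q := (0 : QuadraticForm ℂ V)) φ

theorem contract_ι_mul (φ : Dual ℂ V) (v : V) (x : ExteriorAlgebra ℂ V) :
    contract φ (ι ℂ v * x) = φ v • x - ι ℂ v * contract φ x :=
  CliffordAlgebra.contractLeft_ι_mul φ v x

theorem contract_contract_self (φ : Dual ℂ V) (x : ExteriorAlgebra ℂ V) :
    contract φ (contract φ x) = 0 :=
  CliffordAlgebra.contractLeft_contractLeft φ x

theorem contract_comm (φ ψ : Dual ℂ V) (x : ExteriorAlgebra ℂ V) :
    contract φ (contract ψ x) = -contract ψ (contract φ x) :=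
  CliffordAlgebra.contractLeft_comm φ ψ x

theorem contract_one (φ : Dual ℂ V) : contract φ (1 : ExteriorAlgebra ℂ V) = 0 :=
  CliffordAlgebra.contractLeft_one _ φ

theorem contract_add (φ ψ : Dual ℂ V) : contract (φ + ψ) = contract φ + contract ψ := by
  simp [contract]

theorem contract_sum {I : Type*} (s : Finset I) (φ : I → Dual ℂ V) :
    contract (∑ i ∈ s, φ i) = ∑ i ∈ s, contract (φ i) := by
  simp [contract]

theorem contract_smul (a : ℂ) (φ : Dual ℂ V) : contract (a • φ) = a • contract φ := by
  simp [contract]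

theorem ι_mul_ι_mul_self (v : V) (x : ExteriorAlgebra ℂ V) : ι ℂ v * (ι ℂ v * x) = 0 := by
  rw [← mul_assoc, ExteriorAlgebra.ι_sq_zero, zero_mul]

theorem ι_mul_ι_mul_comm (u v : V) (x : ExteriorAlgebra ℂ V) :
    ι ℂ u * (ι ℂ v * x) = -(ι ℂ v * (ι ℂ u * x)) := by
  rw [← mul_assoc, ← mul_assoc, eq_neg_iff_add_eq_zero, ← add_mul,
    ExteriorAlgebra.ι_add_mul_swap, zero_mul]

/-- Left induction on the exterior algebra. -/
theorem left_induction {C : ExteriorAlgebra ℂ V → Prop}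
    (one : C 1) (smul : ∀ (r : ℂ) x, C x → C (r • x)) (add : ∀ x y, C x → C y → C (x + y))
    (ι_mul : ∀ x v, C x → C (ι ℂ v * x)) (x : ExteriorAlgebra ℂ V) : C x :=
  CliffordAlgebra.left_induction (Q := (0 : QuadraticForm ℂ V))
    (fun r => by rw [Algebra.algebraMap_eq_smul_one]; exact smul r 1 one) add
    (fun x v h => ι_mul x v h) x

theorem eq_contract_of_contract_eq_zero {φ : Dual ℂ V} {v : V} (h : φ v = 1)
    {x : ExteriorAlgebra ℂ V} (hx : contract φ x = 0) : x = contract φ (ι ℂ v * x) := by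
  rw [contract_ι_mul, h, hx]; simp

theorem eq_ι_mul_of_ι_mul_eq_zero {φ : Dual ℂ V} {v : V} (h : φ v = 1)
    {x : ExteriorAlgebra ℂ V} (hx : ι ℂ v * x = 0) : x = ι ℂ v * contract φ x := by
  have := contract_ι_mul φ v x
  rw [hx, h, map_zero, one_smul] at this
  exact (sub_eq_zero.1 this.symm)

theorem map_contract (B : V →ₗ[ℂ] W) (ψ : Dual ℂ W) (x : ExteriorAlgebra ℂ V) :
    ExteriorAlgebra.map B (contract (ψ ∘ₗ B) x) = contract ψ (ExteriorAlgebra.map B x) := by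
  induction x using left_induction with
  | one => simp [contract_one]
  | smul r x h => simp [h]
  | add x y hx hy => simp [hx, hy]
  | ι_mul x v h => simp [contract_ι_mul, h]

/-- The transvection-like identity `Λ(1 - v ⊗ φ) = 1 - v ∧ (φ ⌋ ·)`. -/
theorem map_id_sub_smulRight (φ : Dual ℂ V) (v : V) (x : ExteriorAlgebra ℂ V) :
    ExteriorAlgebra.map (LinearMap.id - φ.smulRight v) x = x - ι ℂ v * contract φ x := by
  induction x using left_induction with
  | one => simp [contract_one]
  | smul r x h => simp [h, smul_sub]
  | add x y hx hy => simp [hx, hy, mul_add]; abel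
  | ι_mul x u h =>
    simp only [map_mul, h, ExteriorAlgebra.map_apply_ι, contract_ι_mul, LinearMap.sub_apply,
      LinearMap.id_apply, LinearMap.smulRight_apply, map_sub, map_smul, sub_mul, mul_sub,
      smul_mul_assoc, mul_smul_comm, ι_mul_ι_mul_self, smul_zero, sub_zero]
    rw [ι_mul_ι_mul_comm u v]
    abel

section Grading

theorem ιMulti_mem (m : ℕ) (x : Fin m → V) :
    ExteriorAlgebra.ιMulti ℂ m x ∈ ⋀[ℂ]^m V :=
  ExteriorAlgebra.ιMulti_range ℂ m (Set.mem_range_self x)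

theorem exteriorPower_le {m : ℕ} {S : Submodule ℂ (ExteriorAlgebra ℂ V)}
    (h : ∀ x : Fin m → V, ExteriorAlgebra.ιMulti ℂ m x ∈ S) : ⋀[ℂ]^m V ≤ S := by
  rw [← ExteriorAlgebra.ιMulti_span_fixedDegree, Submodule.span_le]
  rintro _ ⟨x, rfl⟩
  exact h x

theorem ι_mul_ιMulti (v : V) {m : ℕ} (x : Fin m → V) :
    ι ℂ v * ExteriorAlgebra.ιMulti ℂ m x =
      ExteriorAlgebra.ιMulti ℂ (m + 1) (Fin.cons v x : Fin (m + 1) → V) := by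
  rw [ExteriorAlgebra.ιMulti_succ_apply]
  simp [Matrix.vecTail, Function.comp_def]

theorem ι_mul_mem (v : V) {m : ℕ} {x : ExteriorAlgebra ℂ V} (hx : x ∈ ⋀[ℂ]^m V) :
    ι ℂ v * x ∈ ⋀[ℂ]^(m + 1) V := by
  refine exteriorPower_le (S := (⋀[ℂ]^(m + 1) V).comap (LinearMap.mulLeft ℂ (ι ℂ v)))
    (fun x => ?_) hx
  rw [Submodule.mem_comap, LinearMap.mulLeft_apply, ι_mul_ιMulti]
  exact ιMulti_mem _ _

theorem contract_eq_zero_of_mem_zero (φ : Dual ℂ V) {x : ExteriorAlgebra ℂ V}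
    (hx : x ∈ ⋀[ℂ]^0 V) : contract φ x = 0 := by
  refine exteriorPower_le (S := LinearMap.ker (contract φ)) (fun x => ?_) hx
  rw [LinearMap.mem_ker, ExteriorAlgebra.ιMulti_zero_apply, contract_one]

theorem contract_ιMulti_mem (φ : Dual ℂ V) (m : ℕ) (x : Fin (m + 1) → V) :
    contract φ (ExteriorAlgebra.ιMulti ℂ (m + 1) x) ∈ ⋀[ℂ]^m V := by
  induction m with
  | zero =>
    rw [ExteriorAlgebra.ιMulti_succ_apply, contract_ι_mul, ExteriorAlgebra.ιMulti_zero_apply,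
      contract_one, mul_zero, sub_zero]
    refine Submodule.smul_mem _ _ ?_
    simp
  | succ m ih =>
    rw [ExteriorAlgebra.ιMulti_succ_apply, contract_ι_mul]
    exact Submodule.sub_mem _ (Submodule.smul_mem _ _ (ιMulti_mem _ _)) (ι_mul_mem _ (ih _))

theorem contract_mem (φ : Dual ℂ V) {m : ℕ} {x : ExteriorAlgebra ℂ V}
    (hx : x ∈ ⋀[ℂ]^(m + 1) V) : contract φ x ∈ ⋀[ℂ]^m V :=
  exteriorPower_le (S := (⋀[ℂ]^m V).comap (contract φ)) (contract_ιMulti_mem φ m) hx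

theorem map_mem (B : V →ₗ[ℂ] W) {m : ℕ} {x : ExteriorAlgebra ℂ V} (hx : x ∈ ⋀[ℂ]^m V) :
    ExteriorAlgebra.map B x ∈ ⋀[ℂ]^m W := by
  refine exteriorPower_le
    (S := (⋀[ℂ]^m W).comap (ExteriorAlgebra.map B).toLinearMap) (fun x => ?_) hx
  rw [Submodule.mem_comap, AlgHom.toLinearMap_apply, ExteriorAlgebra.map_apply_ιMulti]
  exact ιMulti_mem _ _

theorem contract_ιMulti_eq_zero (φ : Dual ℂ V) {m : ℕ} (x : Fin m → V) (h : ∀ i, φ (x i) = 0) :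
    contract φ (ExteriorAlgebra.ιMulti ℂ m x) = 0 := by
  induction m with
  | zero => rw [ExteriorAlgebra.ιMulti_zero_apply, contract_one]
  | succ m ih =>
    rw [ExteriorAlgebra.ιMulti_succ_apply, contract_ι_mul, h,
      ih (Matrix.vecTail x) fun i => h i.succ]
    simp

theorem ι_mul_ιMulti_eq_zero {v : V} {m : ℕ} (x : Fin m → V) {i : Fin m} (h : x i = v) :
    ι ℂ v * ExteriorAlgebra.ιMulti ℂ m x = 0 := by
  rw [ι_mul_ιMulti]
  exact (ExteriorAlgebra.ιMulti ℂ (m + 1)).map_eq_zero_of_eq _ (i := 0) (j := i.succ)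
    (by simp [h]) (Fin.succ_ne_zero i).symm

/-- The projection of the exterior algebra onto its degree `m` component. -/
def degreeProj (V : Type*) [AddCommGroup V] [Module ℂ V] (m : ℕ) :
    ExteriorAlgebra ℂ V →ₗ[ℂ] ExteriorAlgebra ℂ V :=
  GradedAlgebra.proj (fun i : ℕ => ⋀[ℂ]^i V) m

theorem degreeProj_of_mem {m : ℕ} {x : ExteriorAlgebra ℂ V} (hx : x ∈ ⋀[ℂ]^m V) :
    degreeProj V m x = x :=
  DirectSum.decompose_of_mem_same (ℳ := fun i : ℕ => ⋀[ℂ]^i V) hx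

theorem degreeProj_of_mem_ne {k m : ℕ} {x : ExteriorAlgebra ℂ V} (hx : x ∈ ⋀[ℂ]^k V)
    (h : k ≠ m) : degreeProj V m x = 0 :=
  DirectSum.decompose_of_mem_ne (ℳ := fun i : ℕ => ⋀[ℂ]^i V) hx h

theorem homogeneous_induction {C : ExteriorAlgebra ℂ V → Prop}
    (zero : C 0) (add : ∀ x y, C x → C y → C (x + y))
    (homogeneous : ∀ (k : ℕ), ∀ x ∈ ⋀[ℂ]^k V, C x) (x : ExteriorAlgebra ℂ V) : C x := by
  induction x using DirectSum.Decomposition.inductionOn fun i => ⋀[ℂ]^i V with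
  | zero => exact zero
  | add x y hx hy => exact add x y hx hy
  | homogeneous x => exact homogeneous _ _ x.2

end Grading

section Vacuum

/-- A vacuum vector for a subspace `U`: an element annihilated by exterior multiplication by
elements of `U` and by contraction with covectors vanishing on `U`. The vacuum vectors form the
line of top exterior forms on `U`. -/
structure IsVacuum (U : Submodule ℂ V) (y : ExteriorAlgebra ℂ V) : Prop where
  ι_mul_eq : ∀ u ∈ U, ι ℂ u * y = 0
  contract_eq : ∀ φ : Dual ℂ V, (∀ u ∈ U, φ u = 0) → contract φ y = 0

theorem coord_apply_ne {I : Type*} (b : Basis I ℂ V) {i j : I} (h : i ≠ j) :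
    b.coord i (b j) = 0 := by
  simp [h.symm]

theorem coord_apply_self {I : Type*} (b : Basis I ℂ V) (i : I) : b.coord i (b i) = 1 := by
  simp

theorem ι_mul_eq_zero_of_coord {I : Type*} [Fintype I] (b : Basis I ℂ V) {u : V}
    {y : ExteriorAlgebra ℂ V} (h : ∀ i, b.coord i u = 0 ∨ ι ℂ (b i) * y = 0) : ι ℂ u * y = 0 := by
  rw [← b.sum_repr u, map_sum, Finset.sum_mul]
  refine Finset.sum_eq_zero fun i _ => ?_
  rw [map_smul, smul_mul_assoc]
  rcases h i with h | h
  · rw [← b.coord_apply, h, zero_smul]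
  · rw [h, smul_zero]

theorem contract_eq_zero_of_coord {I : Type*} [Fintype I] (b : Basis I ℂ V) {φ : Dual ℂ V}
    {y : ExteriorAlgebra ℂ V} (h : ∀ i, φ (b i) = 0 ∨ contract (b.coord i) y = 0) :
    contract φ y = 0 := by
  rw [← b.sum_dual_apply_smul_coord φ, contract_sum, LinearMap.sum_apply]
  refine Finset.sum_eq_zero fun i _ => ?_
  rw [contract_smul, LinearMap.smul_apply]
  rcases h i with h | h
  · rw [h, zero_smul]
  · rw [h, smul_zero]

variable {I : Type*} [DecidableEq I]

/-- A vacuum vector for the span of the basis vectors indexed by `s`. -/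
structure IsBasisVacuum (b : Basis I ℂ V) (s : Finset I) (y : ExteriorAlgebra ℂ V) : Prop where
  ι_mul_eq : ∀ i ∈ s, ι ℂ (b i) * y = 0
  contract_eq : ∀ i ∉ s, contract (b.coord i) y = 0

theorem exists_eq_smul_one_of_contract_eq_zero [Fintype I] (b : Basis I ℂ V)
    {y : ExteriorAlgebra ℂ V} (h : ∀ i, contract (b.coord i) y = 0) :
    ∃ c : ℂ, y = c • (1 : ExteriorAlgebra ℂ V) := by
  have key : ∀ t : Finset I,
      ExteriorAlgebra.map (LinearMap.id - ∑ i ∈ t, (b.coord i).smulRight (b i)) y = y := by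
    intro t
    induction t using Finset.induction_on with
    | empty => simp
    | insert i t hi ih =>
      have hcomp : LinearMap.id - ∑ j ∈ insert i t, (b.coord j).smulRight (b j) =
          (LinearMap.id - (b.coord i).smulRight (b i)) ∘ₗ
            (LinearMap.id - ∑ j ∈ t, (b.coord j).smulRight (b j)) := by
        refine b.ext fun k => ?_
        rw [Finset.sum_insert hi]
        have : b.coord i (∑ j ∈ t, b.coord j (b k) • b j) = 0 := by
          rw [map_sum]
          refine Finset.sum_eq_zero fun j hj => ?_
          rw [map_smul, coord_apply_ne b (ne_of_mem_of_not_mem hj hi).symm, smul_zero]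
        simp only [LinearMap.sub_apply, LinearMap.id_apply, LinearMap.add_apply,
          LinearMap.sum_apply, LinearMap.smulRight_apply, LinearMap.comp_apply, map_sub,
          this, zero_smul, sub_zero]
        abel
      rw [hcomp, ← ExteriorAlgebra.map_comp_map, AlgHom.comp_apply, ih, map_id_sub_smulRight, h i,
        mul_zero, sub_zero]
  have hzero : LinearMap.id - ∑ i, (b.coord i).smulRight (b i) = (0 : V →ₗ[ℂ] V) := by
    refine LinearMap.ext fun v => ?_
    simp
  have scalar : ∀ x : ExteriorAlgebra ℂ V, ∃ c : ℂ,
      ExteriorAlgebra.map (0 : V →ₗ[ℂ] V) x = c • (1 : ExteriorAlgebra ℂ V) := by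
    intro x
    induction x using left_induction with
    | one => exact ⟨1, by simp⟩
    | smul r x h => obtain ⟨c, hc⟩ := h; exact ⟨r * c, by rw [map_smul, hc, smul_smul]⟩
    | add x y hx hy =>
      obtain ⟨c, hc⟩ := hx
      obtain ⟨d, hd⟩ := hy
      exact ⟨c + d, by rw [map_add, hc, hd, add_smul]⟩
    | ι_mul x v _ => exact ⟨0, by simp⟩
  obtain ⟨c, hc⟩ := scalar y
  exact ⟨c, by rw [← hc, ← hzero, key]⟩

theorem IsBasisVacuum.exists_generator [Fintype I] (b : Basis I ℂ V) (s : Finset I) :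
    ∃ y₀, ∀ y, IsBasisVacuum b s y → ∃ c : ℂ, y = c • y₀ := by
  induction s using Finset.induction_on with
  | empty =>
    exact ⟨1, fun y hy =>
      exists_eq_smul_one_of_contract_eq_zero b fun i => hy.contract_eq i (Finset.notMem_empty i)⟩
  | insert i s hi ih =>
    obtain ⟨y₀, h₀⟩ := ih
    refine ⟨ι ℂ (b i) * y₀, fun y hy => ?_⟩
    obtain ⟨c, hc⟩ := h₀ (contract (b.coord i) y) <| by
      refine ⟨fun j hj => ?_, fun j hj => ?_⟩
      · have := contract_ι_mul (b.coord i) (b j) y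
        rw [hy.ι_mul_eq j (Finset.mem_insert_of_mem hj), map_zero,
          coord_apply_ne b (ne_of_mem_of_not_mem hj hi).symm, zero_smul, zero_sub] at this
        exact neg_eq_zero.1 this.symm
      · by_cases hij : j = i
        · rw [hij, contract_contract_self]
        · rw [contract_comm, hy.contract_eq j (by simp [hij, hj]), map_zero, neg_zero]
    refine ⟨c, ?_⟩
    rw [← mul_smul_comm, ← hc]
    exact eq_ι_mul_of_ι_mul_eq_zero (coord_apply_self b i)
      (hy.ι_mul_eq i (Finset.mem_insert_self i s))

theorem IsBasisVacuum.exists_mem [Fintype I] (b : Basis I ℂ V) (s : Finset I)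
    {M : Submodule ℂ (ExteriorAlgebra ℂ V)} (hM : M ≠ ⊥)
    (hι : ∀ i ∈ s, ∀ y ∈ M, ι ℂ (b i) * y ∈ M)
    (hc : ∀ i ∉ s, ∀ y ∈ M, contract (b.coord i) y ∈ M) :
    ∃ y ∈ M, y ≠ 0 ∧ IsBasisVacuum b s y := by
  have key : ∀ t : Finset I, ∃ y ∈ M, y ≠ 0 ∧ (∀ i ∈ t, i ∈ s → ι ℂ (b i) * y = 0) ∧
      ∀ i ∈ t, i ∉ s → contract (b.coord i) y = 0 := by
    intro t
    induction t using Finset.induction_on with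
    | empty =>
      obtain ⟨y, hy, h0⟩ := Submodule.exists_mem_ne_zero_of_ne_bot hM
      exact ⟨y, hy, h0, by simp, by simp⟩
    | insert i t hi ih =>
      obtain ⟨y, hy, h0, h1, h2⟩ := ih
      by_cases his : i ∈ s
      · by_cases hz : ι ℂ (b i) * y = 0
        · refine ⟨y, hy, h0, fun j hj hjs => ?_, fun j hj hjs => ?_⟩
          · rcases Finset.mem_insert.1 hj with rfl | hj
            exacts [hz, h1 j hj hjs]
          · rcases Finset.mem_insert.1 hj with rfl | hj
            exacts [absurd his hjs, h2 j hj hjs]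
        · refine ⟨_, hι i his y hy, hz, fun j hj hjs => ?_, fun j hj hjs => ?_⟩
          · rcases Finset.mem_insert.1 hj with rfl | hj
            · rw [ι_mul_ι_mul_self]
            · rw [ι_mul_ι_mul_comm, h1 j hj hjs, mul_zero, neg_zero]
          · rcases Finset.mem_insert.1 hj with rfl | hj
            · exact absurd his hjs
            · rw [contract_ι_mul, h2 j hj hjs, mul_zero, sub_zero,
                coord_apply_ne b (ne_of_mem_of_not_mem hj hi), zero_smul]
      · by_cases hz : contract (b.coord i) y = 0
        · refine ⟨y, hy, h0, fun j hj hjs => ?_, fun j hj hjs => ?_⟩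
          · rcases Finset.mem_insert.1 hj with rfl | hj
            exacts [absurd hjs his, h1 j hj hjs]
          · rcases Finset.mem_insert.1 hj with rfl | hj
            exacts [hz, h2 j hj hjs]
        · refine ⟨_, hc i his y hy, hz, fun j hj hjs => ?_, fun j hj hjs => ?_⟩
          · rcases Finset.mem_insert.1 hj with rfl | hj
            · exact absurd hjs his
            · have := contract_ι_mul (b.coord i) (b j) y
              rw [h1 j hj hjs, map_zero, coord_apply_ne b (ne_of_mem_of_not_mem hj hi).symm,
                zero_smul,
                zero_sub] at this
              exact neg_eq_zero.1 this.symm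
          · rcases Finset.mem_insert.1 hj with rfl | hj
            · rw [contract_contract_self]
            · rw [contract_comm, h2 j hj hjs, map_zero, neg_zero]
  obtain ⟨y, hy, h0, h1, h2⟩ := key Finset.univ
  exact ⟨y, hy, h0, fun i => h1 i (Finset.mem_univ i), fun i => h2 i (Finset.mem_univ i)⟩

theorem IsBasisVacuum.exists_cyclic (b : Basis I ℂ V) (s : Finset I) :
    ∃ x₀, IsBasisVacuum b s x₀ ∧ ∀ Z : Submodule ℂ (ExteriorAlgebra ℂ V),
      (∀ i ∉ s, ∀ x ∈ Z, ι ℂ (b i) * x ∈ Z) →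
      (∀ i ∈ s, ∀ x ∈ Z, contract (b.coord i) x ∈ Z) → x₀ ∈ Z → Z = ⊤ := by
  induction s using Finset.induction_on with
  | empty =>
    refine ⟨1, ⟨by simp, fun i _ => contract_one _⟩, fun Z hι _ h1 => ?_⟩
    refine (Submodule.eq_top_iff').2 fun x => ?_
    induction x using left_induction with
    | one => exact h1
    | smul r x h => exact Z.smul_mem r h
    | add x y hx hy => exact Z.add_mem hx hy
    | ι_mul x v h =>
      have : ∀ v, v ∈ Z.comap (LinearMap.mulRight ℂ x ∘ₗ ι ℂ) := by
        have htop : (⊤ : Submodule ℂ V) ≤ Z.comap (LinearMap.mulRight ℂ x ∘ₗ ι ℂ) := by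
          rw [← b.span_eq, Submodule.span_le]
          rintro _ ⟨i, rfl⟩
          exact hι i (Finset.notMem_empty i) x h
        exact fun v => htop Submodule.mem_top
      exact this v
  | insert i s hi ih =>
    obtain ⟨x₀, hx₀, hcyc⟩ := ih
    refine ⟨ι ℂ (b i) * x₀, ⟨fun j hj => ?_, fun j hj => ?_⟩, fun Z hι hc hx => ?_⟩
    · rcases Finset.mem_insert.1 hj with rfl | hj
      · rw [ι_mul_ι_mul_self]
      · rw [ι_mul_ι_mul_comm, hx₀.ι_mul_eq j hj, mul_zero, neg_zero]
    · have hji : j ≠ i := fun h => hj (h ▸ Finset.mem_insert_self i s)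
      rw [contract_ι_mul, coord_apply_ne b hji, zero_smul,
        hx₀.contract_eq j (fun h => hj (Finset.mem_insert_of_mem h)), mul_zero, sub_zero]
    · have htop := hcyc (Z.comap (LinearMap.mulLeft ℂ (ι ℂ (b i))))
        (fun j hj x hx => ?_) (fun j hj x hx => ?_) hx
      · refine (Submodule.eq_top_iff').2 fun x => ?_
        have hmem : ∀ y, ι ℂ (b i) * y ∈ Z := fun y => by
          have : y ∈ Z.comap (LinearMap.mulLeft ℂ (ι ℂ (b i))) := htop ▸ Submodule.mem_top
          exact this
        have h1 := hc i (Finset.mem_insert_self i s) _ (hmem x)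
        rw [contract_ι_mul, coord_apply_self, one_smul] at h1
        simpa using Z.add_mem h1 (hmem (contract (b.coord i) x))
      · rw [Submodule.mem_comap, LinearMap.mulLeft_apply] at hx ⊢
        by_cases hji : j = i
        · rw [hji, ι_mul_ι_mul_self]; exact Z.zero_mem
        · rw [ι_mul_ι_mul_comm]
          exact Z.neg_mem (hι j (by simp [hji, hj]) _ hx)
      · rw [Submodule.mem_comap, LinearMap.mulLeft_apply] at hx ⊢
        have hji : j ≠ i := fun h => hi (h ▸ hj)
        have h1 := hc j (Finset.mem_insert_of_mem hj) _ hx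
        rw [contract_ι_mul, coord_apply_ne b hji, zero_smul, zero_sub] at h1
        simpa using Z.neg_mem h1

/-- `b` is a basis adapted to the decomposition `V = U ⊕ C`, with `s` indexing the vectors
of `b` that lie in `U`. -/
structure IsAdapted (b : Basis I ℂ V) (s : Finset I) (U C : Submodule ℂ V) : Prop where
  mem_left : ∀ i ∈ s, b i ∈ U
  mem_right : ∀ i ∉ s, b i ∈ C
  coord_right : ∀ i ∈ s, ∀ c ∈ C, b.coord i c = 0
  coord_left : ∀ i ∉ s, ∀ u ∈ U, b.coord i u = 0

theorem exists_isAdapted [FiniteDimensional ℂ V] {U C : Submodule ℂ V} (h : IsCompl U C) :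
    ∃ (n k : ℕ) (b : Basis (Fin n ⊕ Fin k) ℂ V) (s : Finset (Fin n ⊕ Fin k)),
      IsAdapted b s U C := by
  refine ⟨_, _, ((finBasis ℂ U).prod (finBasis ℂ C)).map (Submodule.prodEquivOfIsCompl U C h),
    Finset.univ.map Function.Embedding.inl, ⟨?_, ?_, ?_, ?_⟩⟩
  · rintro (i | i) hi
    · simp
    · simp at hi
  · rintro (i | i) hi
    · simp at hi
    · simp
  · rintro (i | i) hi c hc
    · have : (Submodule.prodEquivOfIsCompl U C h).symm c = (0, ⟨c, hc⟩) :=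
        Submodule.prodEquivOfIsCompl_symm_apply_right U C h ⟨c, hc⟩
      simp [this]
    · simp at hi
  · rintro (i | i) hi u hu
    · simp at hi
    · have : (Submodule.prodEquivOfIsCompl U C h).symm u = (⟨u, hu⟩, 0) :=
        Submodule.prodEquivOfIsCompl_symm_apply_left U C h ⟨u, hu⟩
      simp [this]

theorem IsAdapted.isBasisVacuum_iff [Fintype I] {b : Basis I ℂ V} {s : Finset I}
    {U C : Submodule ℂ V} (h : IsAdapted b s U C) {y : ExteriorAlgebra ℂ V} :
    IsBasisVacuum b s y ↔ IsVacuum U y := by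
  refine ⟨fun hy => ⟨fun u hu => ?_, fun φ hφ => ?_⟩,
    fun hy => ⟨fun i hi => hy.ι_mul_eq _ (h.mem_left i hi),
      fun i hi => hy.contract_eq _ (h.coord_left i hi)⟩⟩
  · refine ι_mul_eq_zero_of_coord b fun i => ?_
    by_cases hi : i ∈ s
    · exact Or.inr (hy.ι_mul_eq i hi)
    · exact Or.inl (h.coord_left i hi u hu)
  · refine contract_eq_zero_of_coord b fun i => ?_
    by_cases hi : i ∈ s
    · exact Or.inl (hφ _ (h.mem_left i hi))
    · exact Or.inr (hy.contract_eq i hi)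

variable [FiniteDimensional ℂ V]

theorem IsVacuum.exists_generator (U : Submodule ℂ V) :
    ∃ y₀, ∀ y, IsVacuum U y → ∃ c : ℂ, y = c • y₀ := by
  obtain ⟨C, hC⟩ := Submodule.exists_isCompl U
  obtain ⟨_, _, b, s, h⟩ := exists_isAdapted hC
  simpa only [h.isBasisVacuum_iff] using IsBasisVacuum.exists_generator b s

theorem IsVacuum.exists_eq_smul {U : Submodule ℂ V} {y z : ExteriorAlgebra ℂ V}
    (hy : IsVacuum U y) (hz : IsVacuum U z) (h0 : y ≠ 0) : ∃ c : ℂ, z = c • y := by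
  obtain ⟨y₀, h⟩ := IsVacuum.exists_generator U
  obtain ⟨a, rfl⟩ := h y hy
  obtain ⟨c, rfl⟩ := h z hz
  have ha : a ≠ 0 := fun ha => h0 (by rw [ha, zero_smul])
  exact ⟨c * a⁻¹, by rw [smul_smul, mul_assoc, inv_mul_cancel₀ ha, mul_one]⟩

theorem IsVacuum.exists_mem (U : Submodule ℂ V) {M : Submodule ℂ (ExteriorAlgebra ℂ V)}
    (hM : M ≠ ⊥) (hι : ∀ u ∈ U, ∀ y ∈ M, ι ℂ u * y ∈ M)
    (hc : ∀ φ : Dual ℂ V, (∀ u ∈ U, φ u = 0) → ∀ y ∈ M, contract φ y ∈ M) :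
    ∃ y ∈ M, y ≠ 0 ∧ IsVacuum U y := by
  obtain ⟨C, hC⟩ := Submodule.exists_isCompl U
  obtain ⟨_, _, b, s, h⟩ := exists_isAdapted hC
  simpa only [h.isBasisVacuum_iff] using IsBasisVacuum.exists_mem b s hM
    (fun i hi => hι _ (h.mem_left i hi)) (fun i hi => hc _ (h.coord_left i hi))

theorem IsVacuum.eq_top_of_mem {U C : Submodule ℂ V} (hUC : IsCompl U C)
    {Z : Submodule ℂ (ExteriorAlgebra ℂ V)} (hι : ∀ u ∈ C, ∀ y ∈ Z, ι ℂ u * y ∈ Z)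
    (hc : ∀ φ : Dual ℂ V, (∀ u ∈ C, φ u = 0) → ∀ y ∈ Z, contract φ y ∈ Z)
    {y : ExteriorAlgebra ℂ V} (hy : IsVacuum U y) (h0 : y ≠ 0) (hyZ : y ∈ Z) : Z = ⊤ := by
  obtain ⟨_, _, b, s, h⟩ := exists_isAdapted hUC
  obtain ⟨x₀, hx₀, hcyc⟩ := IsBasisVacuum.exists_cyclic b s
  refine hcyc Z (fun i hi => hι _ (h.mem_right i hi)) (fun i hi => hc _ (h.coord_right i hi)) ?_
  obtain ⟨c, rfl⟩ := hy.exists_eq_smul (h.isBasisVacuum_iff.1 hx₀) h0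
  exact Z.smul_mem c hyZ

theorem IsVacuum.exists_ne_zero (U : Submodule ℂ V) : ∃ y, y ≠ 0 ∧ IsVacuum U y := by
  obtain ⟨y, -, h⟩ := IsVacuum.exists_mem U (M := ⊤) top_ne_bot (fun _ _ _ _ => trivial)
    (fun _ _ _ _ => trivial)
  exact ⟨y, h⟩

end Vacuum

section Spinor

theorem exists_dual_comp_eq {X : Type*} [AddCommGroup X] [Module ℂ X] (T : X →ₗ[ℂ] V)
    (g : Dual ℂ X) (h : ∀ x, T x = 0 → g x = 0) : ∃ φ : Dual ℂ V, ∀ x, φ (T x) = g x := by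
  have : g ∈ LinearMap.range T.dualMap := by
    rw [LinearMap.range_dualMap_eq_dualAnnihilator_ker, Submodule.mem_dualAnnihilator]
    exact h
  obtain ⟨φ, hφ⟩ := this
  exact ⟨φ, fun x => by rw [← hφ]; rfl⟩

theorem exists_dual_eq_one {U : Submodule ℂ V} (h : U ≠ ⊤) :
    ∃ (φ : Dual ℂ V) (v : V), φ v = 1 ∧ ∀ u ∈ U, φ u = 0 := by
  obtain ⟨f, hf, hU⟩ := Submodule.exists_le_ker_of_lt_top U (lt_top_iff_ne_top.2 h)
  obtain ⟨v, hv⟩ : ∃ v, f v ≠ 0 := by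
    by_contra! h0
    exact hf (LinearMap.ext h0)
  exact ⟨f, (f v)⁻¹ • v, by simp [hv], fun u hu => hU hu⟩

/-- A pair of covectors which agree along the relation `P`. -/
def IsConormal (P : Submodule ℂ (V × W)) (φ : Dual ℂ V) (ψ : Dual ℂ W) : Prop :=
  ∀ p ∈ P, φ p.1 = ψ p.2

theorem mem_relKer {P : Submodule ℂ (V × W)} {v : V} : v ∈ relKer P ↔ (v, (0 : W)) ∈ P := Iff.rfl

theorem mem_relIndef {P : Submodule ℂ (V × W)} {w : W} : w ∈ relIndef P ↔ ((0 : V), w) ∈ P :=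
  Iff.rfl

theorem mem_relDom {P : Submodule ℂ (V × W)} {v : V} : v ∈ relDom P ↔ ∃ w, (v, w) ∈ P := by
  simp [relDom]

theorem mem_relIm {P : Submodule ℂ (V × W)} {w : W} : w ∈ relIm P ↔ ∃ v, (v, w) ∈ P := by
  simp [relIm]

theorem relKer_le_relDom (P : Submodule ℂ (V × W)) : relKer P ≤ relDom P := fun _ hv =>
  mem_relDom.2 ⟨0, hv⟩

theorem relIndef_le_relIm (P : Submodule ℂ (V × W)) : relIndef P ≤ relIm P := fun _ hw =>
  mem_relIm.2 ⟨0, hw⟩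

theorem exists_isConormal_left {P : Submodule ℂ (V × W)} {U : Submodule ℂ V}
    (hU : Disjoint U (relDom P)) {ψ : Dual ℂ W} (hψ : ∀ w ∈ relIndef P, ψ w = 0) :
    ∃ φ, IsConormal P φ ψ ∧ ∀ u ∈ U, φ u = 0 := by
  obtain ⟨φ, hφ⟩ := exists_dual_comp_eq
    ((LinearMap.fst ℂ V W ∘ₗ P.subtype).coprod U.subtype)
    ((ψ ∘ₗ LinearMap.snd ℂ V W ∘ₗ P.subtype) ∘ₗ LinearMap.fst ℂ P U) <| by
      rintro ⟨⟨⟨v, w⟩, hp⟩, ⟨u, hu⟩⟩ h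
      replace h : v + u = 0 := h
      have hv : v ∈ relDom P := mem_relDom.2 ⟨w, hp⟩
      have hu0 : u = 0 := Submodule.disjoint_def.1 hU u hu
        (by rw [eq_neg_of_add_eq_zero_right h]; exact Submodule.neg_mem _ hv)
      rw [hu0, add_zero] at h
      exact hψ w (mem_relIndef.2 (h ▸ hp))
  refine ⟨φ, fun p hp => ?_, fun u hu => ?_⟩
  · simpa using hφ (⟨p, hp⟩, 0)
  · simpa using hφ (0, ⟨u, hu⟩)

theorem exists_isConormal_right {P : Submodule ℂ (V × W)} {φ : Dual ℂ V}
    (hφ : ∀ v ∈ relKer P, φ v = 0) : ∃ ψ, IsConormal P φ ψ := by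
  obtain ⟨ψ, hψ⟩ := exists_dual_comp_eq (LinearMap.snd ℂ V W ∘ₗ P.subtype)
    (φ ∘ₗ LinearMap.fst ℂ V W ∘ₗ P.subtype) <| by
      rintro ⟨⟨v, w⟩, hp⟩ h
      replace h : w = 0 := h
      exact hφ v (mem_relKer.2 (h ▸ hp))
  exact ⟨ψ, fun p hp => (hψ ⟨p, hp⟩).symm⟩

theorem IsConormal.exists_of_relComp {Q : Submodule ℂ (W × Y)} {P : Submodule ℂ (V × W)}
    {φ : Dual ℂ V} {χ : Dual ℂ Y} (h : IsConormal (relComp Q P) φ χ) :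
    ∃ ψ, IsConormal P φ ψ ∧ IsConormal Q ψ χ := by
  obtain ⟨ψ, hψ⟩ := exists_dual_comp_eq
    ((LinearMap.snd ℂ V W ∘ₗ P.subtype).coprod (LinearMap.fst ℂ W Y ∘ₗ Q.subtype))
    ((φ ∘ₗ LinearMap.fst ℂ V W ∘ₗ P.subtype).coprod
      (χ ∘ₗ LinearMap.snd ℂ W Y ∘ₗ Q.subtype)) <| by
      rintro ⟨⟨⟨v, w⟩, hp⟩, ⟨⟨w', y⟩, hq⟩⟩ hw
      replace hw : w + w' = 0 := hw
      have hq' : (w, -y) ∈ Q := by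
        have := Q.neg_mem hq
        rwa [Prod.neg_mk, ← eq_neg_of_add_eq_zero_left hw] at this
      have := h (v, -y) ⟨w, hp, hq'⟩
      change φ v + χ y = 0
      rw [this]
      simp
  refine ⟨ψ, fun p hp => ?_, fun q hq => ?_⟩
  · simpa using (hψ (⟨p, hp⟩, 0)).symm
  · simpa using hψ (0, ⟨q, hq⟩)

/-- An operator between exterior algebras intertwining exterior multiplication and contraction
along the relation `P`. Such operators form a line, spanned by `λ(P)`. -/
structure IsSpinor (P : Submodule ℂ (V × W))
    (L : ExteriorAlgebra ℂ V →ₗ[ℂ] ExteriorAlgebra ℂ W) : Prop where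
  map_ι_mul : ∀ p ∈ P, ∀ x, L (ι ℂ p.1 * x) = ι ℂ p.2 * L x
  map_contract : ∀ φ ψ, IsConormal P φ ψ → ∀ x, L (contract φ x) = contract ψ (L x)

variable {P : Submodule ℂ (V × W)} {Q : Submodule ℂ (W × Y)}
  {L L' : ExteriorAlgebra ℂ V →ₗ[ℂ] ExteriorAlgebra ℂ W}
  {M : ExteriorAlgebra ℂ W →ₗ[ℂ] ExteriorAlgebra ℂ Y}

namespace IsSpinor

theorem comp (hM : IsSpinor Q M) (hL : IsSpinor P L) : IsSpinor (relComp Q P) (M ∘ₗ L) where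
  map_ι_mul := by
    rintro ⟨v, y⟩ ⟨w, h₁, h₂⟩ x
    simp only [LinearMap.comp_apply]
    rw [hL.map_ι_mul _ h₁, hM.map_ι_mul _ h₂]
  map_contract φ χ h x := by
    obtain ⟨ψ, h₁, h₂⟩ := h.exists_of_relComp
    simp only [LinearMap.comp_apply]
    rw [hL.map_contract _ _ h₁, hM.map_contract _ _ h₂]

theorem sub_smul (hL : IsSpinor P L) (hL' : IsSpinor P L') (c : ℂ) :
    IsSpinor P (L - c • L') where
  map_ι_mul p hp x := by
    simp [hL.map_ι_mul p hp, hL'.map_ι_mul p hp, mul_sub]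
  map_contract φ ψ h x := by
    simp [hL.map_contract φ ψ h, hL'.map_contract φ ψ h]

theorem map_contract_eq_zero (hL : IsSpinor P L) {φ : Dual ℂ V} (hφ : ∀ v ∈ relDom P, φ v = 0)
    (x : ExteriorAlgebra ℂ V) : L (contract φ x) = 0 := by
  rw [hL.map_contract φ 0 fun p hp => hφ p.1 (mem_relDom.2 ⟨p.2, hp⟩)]
  simp [contract]

theorem map_ι_mul_eq_zero (hL : IsSpinor P L) {v : V} (hv : v ∈ relKer P)
    (x : ExteriorAlgebra ℂ V) : L (ι ℂ v * x) = 0 := by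
  rw [hL.map_ι_mul (v, 0) hv, map_zero, zero_mul]

theorem contract_map_eq_zero (hL : IsSpinor P L) {ψ : Dual ℂ W} (hψ : ∀ w ∈ relIm P, ψ w = 0)
    (x : ExteriorAlgebra ℂ V) : contract ψ (L x) = 0 := by
  rw [← hL.map_contract 0 ψ fun p hp => (hψ p.2 (mem_relIm.2 ⟨p.1, hp⟩)).symm]
  simp [contract]

theorem ι_mul_map_eq_zero (hL : IsSpinor P L) {w : W} (hw : w ∈ relIndef P)
    (x : ExteriorAlgebra ℂ V) : ι ℂ w * L x = 0 := by
  rw [← hL.map_ι_mul (0, w) hw, map_zero, zero_mul, map_zero]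

theorem eq_zero_of_isVacuum [FiniteDimensional ℂ V] (hL : IsSpinor P L) {U C : Submodule ℂ V}
    (hUC : IsCompl U C) (hKC : relKer P ≤ C) (hCD : C ≤ relDom P) {x : ExteriorAlgebra ℂ V}
    (hx : IsVacuum U x) (h0 : x ≠ 0) (hLx : L x = 0) : L = 0 := by
  rw [← LinearMap.ker_eq_top]
  refine IsVacuum.eq_top_of_mem hUC (fun u hu y hy => ?_) (fun φ hφ y hy => ?_) hx h0 hLx
  · obtain ⟨w, hw⟩ := mem_relDom.1 (hCD hu)
    rw [LinearMap.mem_ker] at hy ⊢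
    rw [hL.map_ι_mul _ hw, hy, mul_zero]
  · obtain ⟨ψ, hψ⟩ := exists_isConormal_right (P := P) fun v hv => hφ v (hKC hv)
    rw [LinearMap.mem_ker] at hy ⊢
    rw [hL.map_contract _ _ hψ, hy, map_zero]

theorem isVacuum_map (hL : IsSpinor P L) {U : Submodule ℂ V} (hU : Disjoint U (relDom P))
    {x : ExteriorAlgebra ℂ V} (hx : IsVacuum U x) : IsVacuum (relIndef P) (L x) where
  ι_mul_eq _ hw := hL.ι_mul_map_eq_zero hw x
  contract_eq ψ hψ := by
    obtain ⟨φ, hφ, h0⟩ := exists_isConormal_left hU hψ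
    rw [← hL.map_contract _ _ hφ, hx.contract_eq φ h0, map_zero]

theorem exists_eq_smul [FiniteDimensional ℂ V] [FiniteDimensional ℂ W] (hL : IsSpinor P L)
    (hL' : IsSpinor P L') (h0 : L ≠ 0) : ∃ c : ℂ, L' = c • L := by
  obtain ⟨U, hU⟩ := Submodule.exists_isCompl (relDom P)
  obtain ⟨x, hx0, hx⟩ := IsVacuum.exists_ne_zero U
  have hLx : L x ≠ 0 := fun h =>
    h0 (hL.eq_zero_of_isVacuum hU.symm (relKer_le_relDom P) le_rfl hx hx0 h)
  obtain ⟨c, hc⟩ := (hL.isVacuum_map hU.symm.disjoint hx).exists_eq_smul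
    (hL'.isVacuum_map hU.symm.disjoint hx) hLx
  refine ⟨c, sub_eq_zero.1 ?_⟩
  exact (hL'.sub_smul hL c).eq_zero_of_isVacuum hU.symm (relKer_le_relDom P) le_rfl hx hx0
    (by simp [hc])

end IsSpinor

theorem exists_isCompl_le {X Z : Submodule ℂ V} (h : X ⊔ Z = ⊤) :
    ∃ C, IsCompl X C ∧ C ≤ Z := by
  obtain ⟨C, hC⟩ := exists_isCompl (X ⊓ Z)
  refine ⟨C ⊓ Z, ⟨?_, ?_⟩, inf_le_right⟩
  · rw [disjoint_iff, inf_comm C, ← inf_assoc]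
    exact hC.inf_eq_bot
  · rw [codisjoint_iff, eq_top_iff, ← h]
    refine sup_le le_sup_left ?_
    have : X ⊓ Z ⊔ C ⊓ Z = Z := by
      rw [← sup_inf_assoc_of_le C inf_le_right, hC.sup_eq_top, top_inf_eq]
    calc Z = X ⊓ Z ⊔ C ⊓ Z := this.symm
      _ ≤ X ⊔ C ⊓ Z := sup_le_sup_right inf_le_left _

theorem exists_isCompl_between {A I K D : Submodule ℂ V} (hAI : A ≤ I) (hKD : K ≤ D)
    (hID : I ⊔ D = ⊤) (hAK : A ⊓ K = ⊥) :
    ∃ U C, IsCompl U C ∧ A ≤ U ∧ U ≤ I ∧ K ≤ C ∧ C ≤ D := by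
  obtain ⟨U', hU', hU'I⟩ := exists_isCompl_le (X := A ⊔ D) (Z := I)
    (by rw [eq_top_iff, ← hID]; exact sup_le le_sup_right (le_sup_right.trans le_sup_left))
  have hUD : A ⊔ U' ⊔ D = ⊤ := by rw [sup_right_comm, hU'.sup_eq_top]
  have hUK : (A ⊔ U') ⊓ K = ⊥ := by
    rw [← disjoint_iff, disjoint_comm]
    refine Disjoint.disjoint_sup_right_of_disjoint_sup_left
      (disjoint_iff.2 (by rw [inf_comm, hAK])) ?_
    exact hU'.disjoint.mono_left (sup_le (hKD.trans le_sup_right) le_sup_left)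
  obtain ⟨C', hC', hC'D⟩ := exists_isCompl_le (X := A ⊔ U' ⊔ K) (Z := D)
    (by rw [eq_top_iff, ← hUD]; exact sup_le_sup_right le_sup_left _)
  refine ⟨A ⊔ U', K ⊔ C', ⟨?_, ?_⟩, le_sup_left, sup_le hAI hU'I, le_sup_left,
    sup_le hKD hC'D⟩
  · exact Disjoint.disjoint_sup_right_of_disjoint_sup_left (disjoint_iff.2 hUK) hC'.disjoint
  · rw [codisjoint_iff, ← sup_assoc, hC'.sup_eq_top]

namespace IsSpinor

theorem comp_ne_zero [FiniteDimensional ℂ W] (hM : IsSpinor Q M) (hL : IsSpinor P L)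
    (hQP : Transversal Q P) (hM0 : M ≠ 0) (hL0 : L ≠ 0) : M ∘ₗ L ≠ 0 := by
  obtain ⟨U, C, hUC, hAU, hUI, hKC, hCD⟩ := exists_isCompl_between (relIndef_le_relIm P)
    (relKer_le_relDom Q) hQP.1 hQP.2
  obtain ⟨y, ⟨x, rfl⟩, hy0, hy⟩ := IsVacuum.exists_mem U (M := LinearMap.range L)
    (fun h => hL0 (LinearMap.range_eq_bot.1 h)) (by
      rintro u hu _ ⟨x, rfl⟩
      obtain ⟨v, hv⟩ := mem_relIm.1 (hUI hu)
      exact ⟨_, hL.map_ι_mul _ hv x⟩) (by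
      rintro ψ hψ _ ⟨x, rfl⟩
      obtain ⟨φ, hφ, -⟩ := exists_isConormal_left (P := P) (U := ⊥) disjoint_bot_left
        fun w hw => hψ w (hAU hw)
      exact ⟨_, hL.map_contract _ _ hφ x⟩)
  intro h
  exact hM0 (hM.eq_zero_of_isVacuum hUC hKC hCD hy hy0 (LinearMap.congr_fun h x))

theorem comp_eq_zero (hM : IsSpinor Q M) (hL : IsSpinor P L) (hQP : ¬Transversal Q P) :
    M ∘ₗ L = 0 := by
  refine LinearMap.ext fun x => ?_
  rw [LinearMap.comp_apply, LinearMap.zero_apply]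
  rcases not_and_or.1 hQP with h | h
  · obtain ⟨φ, v, hv, hφ⟩ := exists_dual_eq_one h
    rw [eq_contract_of_contract_eq_zero hv
      (hL.contract_map_eq_zero (fun w hw => hφ w (Submodule.mem_sup_left hw)) x)]
    exact hM.map_contract_eq_zero (fun w hw => hφ w (Submodule.mem_sup_right hw)) _
  · obtain ⟨w, ⟨hwP, hwQ⟩, hw0⟩ := Submodule.exists_mem_ne_zero_of_ne_bot h
    obtain ⟨φ, hφ⟩ := Module.Projective.exists_dual_eq_one ℂ hw0
    rw [eq_ι_mul_of_ι_mul_eq_zero hφ (hL.ι_mul_map_eq_zero hwP x)]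
    exact hM.map_ι_mul_eq_zero hwQ _

end IsSpinor

end Spinor

section Degree

theorem ι_mul_ιMulti_eq_zero_of_mem_span {v : V} {m : ℕ} (x : Fin m → V)
    (h : v ∈ Submodule.span ℂ (Set.range x)) : ι ℂ v * ExteriorAlgebra.ιMulti ℂ m x = 0 := by
  induction h using Submodule.span_induction with
  | mem v hv =>
    obtain ⟨i, hi⟩ := hv
    exact ι_mul_ιMulti_eq_zero x hi
  | zero => simp
  | add u v _ _ hu hv => rw [map_add, add_mul, hu, hv, add_zero]
  | smul a v _ hv => rw [map_smul, smul_mul_assoc, hv, smul_zero]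

variable [FiniteDimensional ℂ V] {P P' : Submodule ℂ (V × W)}
  {L L' : ExteriorAlgebra ℂ V →ₗ[ℂ] ExteriorAlgebra ℂ W} {k m : ℕ} {x : ExteriorAlgebra ℂ V}

theorem IsSpinor.map_eq_zero_of_lt (hL : IsSpinor P L) (hx : x ∈ ⋀[ℂ]^k V)
    (hk : k + finrank ℂ (relDom P) < finrank ℂ V) : L x = 0 := by
  refine (exteriorPower_le (S := LinearMap.ker L) fun y => ?_) hx
  obtain ⟨φ, v, hv, hφ⟩ := exists_dual_eq_one
    (U := Submodule.span ℂ (Set.range y) ⊔ relDom P) fun h => by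
      have h1 := Submodule.finrank_add_le_finrank_add_finrank
        (Submodule.span ℂ (Set.range y)) (relDom P)
      have h2 := finrank_range_le_card (R := ℂ) y
      rw [h, finrank_top] at h1
      rw [Fintype.card_fin] at h2
      unfold Set.finrank at h2
      omega
  rw [LinearMap.mem_ker, eq_contract_of_contract_eq_zero hv (contract_ιMulti_eq_zero φ y fun i =>
    hφ _ (Submodule.mem_sup_left (Submodule.subset_span ⟨i, rfl⟩)))]
  exact hL.map_contract_eq_zero (fun w hw => hφ w (Submodule.mem_sup_right hw)) _

theorem IsSpinor.map_eq_zero_of_gt (hL : IsSpinor P L) (hx : x ∈ ⋀[ℂ]^k V)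
    (hk : finrank ℂ V < k + finrank ℂ (relKer P)) : L x = 0 := by
  refine (exteriorPower_le (S := LinearMap.ker L) fun y => ?_) hx
  rw [LinearMap.mem_ker]
  by_cases hy : LinearIndependent ℂ y
  · obtain ⟨v, ⟨hvy, hvK⟩, hv0⟩ := Submodule.exists_mem_ne_zero_of_ne_bot
      (p := Submodule.span ℂ (Set.range y) ⊓ relKer P) fun h => by
        have h1 := Submodule.finrank_sup_add_finrank_inf_eq
          (Submodule.span ℂ (Set.range y)) (relKer P)
        have h2 := Submodule.finrank_le (Submodule.span ℂ (Set.range y) ⊔ relKer P)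
        rw [h, finrank_bot, finrank_span_eq_card hy, Fintype.card_fin] at h1
        omega
    obtain ⟨φ, hφ⟩ := Module.Projective.exists_dual_eq_one ℂ hv0
    rw [eq_ι_mul_of_ι_mul_eq_zero hφ (ι_mul_ιMulti_eq_zero_of_mem_span y hvy)]
    exact hL.map_ι_mul_eq_zero hvK _
  · rw [AlternatingMap.map_linearDependent _ _ hy, map_zero]

theorem finrank_relDom_add_finrank_relIndef [FiniteDimensional ℂ W] (P : Submodule ℂ (V × W)) :
    finrank ℂ (relDom P) + finrank ℂ (relIndef P) = finrank ℂ P := by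
  have h := LinearMap.finrank_range_add_finrank_ker (LinearMap.fst ℂ V W ∘ₗ P.subtype)
  rw [LinearMap.range_comp, Submodule.range_subtype] at h
  rw [← h]
  refine congrArg₂ _ rfl (LinearEquiv.finrank_eq ?_)
  exact
    { toFun := fun w => ⟨⟨(0, w.1), w.2⟩, rfl⟩
      invFun := fun p => ⟨p.1.1.2, by
        obtain ⟨⟨⟨v, w⟩, hp⟩, h⟩ := p
        obtain rfl : v = 0 := h
        exact hp⟩
      map_add' := fun u v => by ext <;> simp
      map_smul' := fun u v => by ext <;> simp
      left_inv := fun w => rfl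
      right_inv := by
        rintro ⟨⟨⟨v, w⟩, hp⟩, h⟩
        obtain rfl : v = 0 := h
        rfl }

theorem finrank_relIm_add_finrank_relKer [FiniteDimensional ℂ W] (P : Submodule ℂ (V × W)) :
    finrank ℂ (relIm P) + finrank ℂ (relKer P) = finrank ℂ P := by
  have h := LinearMap.finrank_range_add_finrank_ker (LinearMap.snd ℂ V W ∘ₗ P.subtype)
  rw [LinearMap.range_comp, Submodule.range_subtype] at h
  rw [← h]
  refine congrArg₂ _ rfl (LinearEquiv.finrank_eq ?_)
  exact
    { toFun := fun w => ⟨⟨(w.1, 0), w.2⟩, rfl⟩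
      invFun := fun p => ⟨p.1.1.1, by
        obtain ⟨⟨⟨v, w⟩, hp⟩, h⟩ := p
        obtain rfl : w = 0 := h
        exact hp⟩
      map_add' := fun u v => by ext <;> simp
      map_smul' := fun u v => by ext <;> simp
      left_inv := fun w => rfl
      right_inv := by
        rintro ⟨⟨⟨v, w⟩, hp⟩, h⟩
        obtain rfl : w = 0 := h
        rfl }

end Degree

section Hinge

theorem IsConormal.fst_eq_zero {A : Submodule ℂ V} {B : Submodule ℂ W} {φ : Dual ℂ V}
    {ψ : Dual ℂ W} (h : IsConormal (A.prod B) φ ψ) {v : V} (hv : v ∈ A) : φ v = 0 := by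
  simpa using h (v, 0) ⟨hv, B.zero_mem⟩

theorem IsConormal.snd_eq_zero {A : Submodule ℂ V} {B : Submodule ℂ W} {φ : Dual ℂ V}
    {ψ : Dual ℂ W} (h : IsConormal (A.prod B) φ ψ) {w : W} (hw : w ∈ B) : ψ w = 0 := by
  simpa using (h (0, w) ⟨A.zero_mem, hw⟩).symm

variable {P P' : Submodule ℂ (V × W)}
  {L L' : ExteriorAlgebra ℂ V →ₗ[ℂ] ExteriorAlgebra ℂ W} {m : ℕ}

theorem IsSpinor.comp_degreeProj_of_gt (hL : IsSpinor P L)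
    (hm : ∀ k > m, ∀ x ∈ ⋀[ℂ]^k V, L x = 0) :
    IsSpinor ((relKer P).prod (relIm P)) (L ∘ₗ degreeProj V m) where
  map_ι_mul := by
    rintro ⟨v, w⟩ ⟨hv, hw⟩ x
    induction x using homogeneous_induction with
    | zero => simp
    | add x y hx hy => simp only [mul_add, map_add, hx, hy]
    | homogeneous k x hx =>
      obtain ⟨u, hu⟩ := mem_relIm.1 hw
      simp only [LinearMap.comp_apply]
      have h1 : L (degreeProj V m (ι ℂ v * x)) = 0 := by
        rcases eq_or_ne (k + 1) m with rfl | h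
        · rw [degreeProj_of_mem (ι_mul_mem v hx), hL.map_ι_mul_eq_zero hv]
        · rw [degreeProj_of_mem_ne (ι_mul_mem v hx) h, map_zero]
      rw [h1]
      rcases eq_or_ne k m with rfl | h
      · rw [degreeProj_of_mem hx, ← hL.map_ι_mul _ hu, hm (k + 1) k.lt_succ_self _ (ι_mul_mem u hx)]
      · rw [degreeProj_of_mem_ne hx h, map_zero, mul_zero]
  map_contract φ ψ h x := by
    obtain ⟨ψ', hψ'⟩ := exists_isConormal_right (P := P) fun v hv => h.fst_eq_zero hv
    simp only [LinearMap.comp_apply]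
    rw [hL.contract_map_eq_zero fun w hw => h.snd_eq_zero hw]
    induction x using homogeneous_induction with
    | zero => simp
    | add x y hx hy => simp only [map_add, hx, hy, add_zero]
    | homogeneous k x hx =>
      rcases k with _ | k
      · rw [contract_eq_zero_of_mem_zero φ hx, map_zero, map_zero]
      rcases eq_or_ne k m with rfl | h
      · rw [degreeProj_of_mem (contract_mem φ hx), hL.map_contract _ _ hψ',
          hm (k + 1) k.lt_succ_self x hx, map_zero]
      · rw [degreeProj_of_mem_ne (contract_mem φ hx) h, map_zero]

theorem IsSpinor.comp_degreeProj_of_lt (hL : IsSpinor P L)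
    (hm : ∀ k < m, ∀ x ∈ ⋀[ℂ]^k V, L x = 0) :
    IsSpinor ((relDom P).prod (relIndef P)) (L ∘ₗ degreeProj V m) where
  map_ι_mul := by
    rintro ⟨v, w⟩ ⟨hv, hw⟩ x
    obtain ⟨w', hw'⟩ := mem_relDom.1 hv
    simp only [LinearMap.comp_apply]
    rw [hL.ι_mul_map_eq_zero hw]
    induction x using homogeneous_induction with
    | zero => simp
    | add x y hx hy => simp only [mul_add, map_add, hx, hy, add_zero]
    | homogeneous k x hx =>
      rcases eq_or_ne (k + 1) m with rfl | h
      · rw [degreeProj_of_mem (ι_mul_mem v hx), hL.map_ι_mul _ hw', hm k k.lt_succ_self x hx,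
          mul_zero]
      · rw [degreeProj_of_mem_ne (ι_mul_mem v hx) h, map_zero]
  map_contract φ ψ h x := by
    obtain ⟨φ', hφ', -⟩ := exists_isConormal_left (P := P) (U := ⊥) disjoint_bot_left
      fun w hw => h.snd_eq_zero hw
    induction x using homogeneous_induction with
    | zero => simp
    | add x y hx hy => simp only [map_add, hx, hy]
    | homogeneous k x hx =>
      simp only [LinearMap.comp_apply]
      have h1 : L (degreeProj V m (contract φ x)) = 0 := by
        rcases k with _ | k
        · rw [contract_eq_zero_of_mem_zero φ hx, map_zero, map_zero]
        rcases eq_or_ne k m with rfl | hk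
        · rw [degreeProj_of_mem (contract_mem φ hx),
            hL.map_contract_eq_zero fun v hv => h.fst_eq_zero hv]
        · rw [degreeProj_of_mem_ne (contract_mem φ hx) hk, map_zero]
      rw [h1]
      rcases eq_or_ne k m with rfl | hk
      · rw [degreeProj_of_mem hx, ← hL.map_contract _ _ hφ']
        rcases k with _ | k
        · rw [contract_eq_zero_of_mem_zero φ' hx, map_zero]
        · exact (hm k k.lt_succ_self _ (contract_mem φ' hx)).symm
      · rw [degreeProj_of_mem_ne hx hk, map_zero, map_zero]

/-- The degree `m` components of the operators of two terms of a hinge are proportional. -/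
theorem IsSpinor.exists_eq_smul_of_hinge [FiniteDimensional ℂ V] [FiniteDimensional ℂ W]
    (hL : IsSpinor P L) (hL' : IsSpinor P' L') (hP : finrank ℂ P = finrank ℂ V)
    (hP' : finrank ℂ P' = finrank ℂ V) (hDK : relDom P' ≤ relKer P)
    (hII : relIm P ≤ relIndef P') {x y : ExteriorAlgebra ℂ V} (hx : x ∈ ⋀[ℂ]^m V)
    (hLx : L x ≠ 0) (hy : y ∈ ⋀[ℂ]^m V) (hLy : L' y ≠ 0) :
    ∃ c : ℂ, c ≠ 0 ∧ ∀ z ∈ ⋀[ℂ]^m V, L' z = c • L z := by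
  have h1 : m + finrank ℂ (relKer P) ≤ finrank ℂ V :=
    not_lt.1 fun h => hLx (hL.map_eq_zero_of_gt hx h)
  have h2 : finrank ℂ V ≤ m + finrank ℂ (relDom P') :=
    not_lt.1 fun h => hLy (hL'.map_eq_zero_of_lt hy h)
  have h3 := Submodule.finrank_mono hDK
  have h4 := finrank_relDom_add_finrank_relIndef P'
  have h5 := finrank_relIm_add_finrank_relKer P
  have hDK' : relDom P' = relKer P := Submodule.eq_of_le_of_finrank_eq hDK (by omega)
  have hII' : relIm P = relIndef P' := Submodule.eq_of_le_of_finrank_eq hII (by omega)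
  have hM := hL.comp_degreeProj_of_gt (m := m) fun k hk z hz =>
    hL.map_eq_zero_of_gt hz (by omega)
  have hM' := hL'.comp_degreeProj_of_lt (m := m) fun k hk z hz =>
    hL'.map_eq_zero_of_lt hz (by omega)
  rw [hDK', ← hII'] at hM'
  obtain ⟨c, hc⟩ := hM.exists_eq_smul hM' fun h => hLx <| by
    simpa [degreeProj_of_mem hx] using LinearMap.congr_fun h x
  have hc' : ∀ z ∈ ⋀[ℂ]^m V, L' z = c • L z := fun z hz => by
    simpa [degreeProj_of_mem hz] using LinearMap.congr_fun hc z
  refine ⟨c, ?_, hc'⟩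
  rintro rfl
  exact hLy (by rw [hc' y hy, zero_smul])

theorem _root_.IsWeakHinge.relDom_le_relKer_s13 {s : ℕ} {R : Fin s → Submodule ℂ (V × V)}
    (hR : IsWeakHinge R) {j j' : Fin s} (h : j < j') : relDom (R j') ≤ relKer (R j) := by
  obtain ⟨j, hj⟩ := j
  obtain ⟨j', hj'⟩ := j'
  replace h : j + 1 ≤ j' := h
  induction j', h using Nat.le_induction with
  | base => exact hR.dom_le_ker j hj'
  | succ k h ih =>
    exact (hR.dom_le_ker k hj').trans ((relKer_le_relDom _).trans (ih (by omega)))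

theorem _root_.IsWeakHinge.relIm_le_relIndef_s13 {s : ℕ} {R : Fin s → Submodule ℂ (V × V)}
    (hR : IsWeakHinge R) {j j' : Fin s} (h : j < j') : relIm (R j) ≤ relIndef (R j') := by
  obtain ⟨j, hj⟩ := j
  obtain ⟨j', hj'⟩ := j'
  replace h : j + 1 ≤ j' := h
  induction j', h using Nat.le_induction with
  | base => exact hR.im_le_indef j hj'
  | succ k h ih =>
    exact (ih (by omega)).trans ((relIndef_le_relIm _).trans (hR.im_le_indef k hj'))

theorem _root_.IsWeakHinge.exists_eq_smul [FiniteDimensional ℂ V] {s : ℕ}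
    {R : Fin s → Submodule ℂ (V × V)} (hR : IsWeakHinge R) {j j' : Fin s}
    {L L' : ExteriorAlgebra ℂ V →ₗ[ℂ] ExteriorAlgebra ℂ V} (hL : IsSpinor (R j) L)
    (hL' : IsSpinor (R j') L') {x y : ExteriorAlgebra ℂ V} (hx : x ∈ ⋀[ℂ]^m V)
    (hLx : L x ≠ 0) (hy : y ∈ ⋀[ℂ]^m V) (hLy : L' y ≠ 0) :
    ∃ c : ℂ, c ≠ 0 ∧ ∀ z ∈ ⋀[ℂ]^m V, L' z = c • L z := by
  rcases lt_trichotomy j j' with h | rfl | h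
  · exact hL.exists_eq_smul_of_hinge hL' (hR.dim_eq j) (hR.dim_eq j') (hR.relDom_le_relKer_s13 h)
      (hR.relIm_le_relIndef_s13 h) hx hLx hy hLy
  · obtain ⟨c, rfl⟩ := hL.exists_eq_smul hL' fun h => hLx (by simp [h])
    refine ⟨c, ?_, fun z _ => rfl⟩
    rintro rfl
    exact hLy (by simp)
  · obtain ⟨c, hc, hc'⟩ := hL'.exists_eq_smul_of_hinge hL (hR.dim_eq j') (hR.dim_eq j)
      (hR.relDom_le_relKer_s13 h) (hR.relIm_le_relIndef_s13 h) hy hLy hx hLx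
    exact ⟨c⁻¹, inv_ne_zero hc, fun z hz => by rw [hc' z hz, inv_smul_smul₀ hc]⟩

end Hinge

section Canonical

theorem span_range_finBasis [FiniteDimensional ℂ V] (N : Submodule ℂ V) :
    Submodule.span ℂ (Set.range fun i => (finBasis ℂ N i : V)) = N := by
  have h : (Set.range fun i => (finBasis ℂ N i : V)) = N.subtype '' Set.range (finBasis ℂ N) := by
    rw [← Set.range_comp]
    rfl
  rw [h, Submodule.span_image, Basis.span_eq, Submodule.map_top, Submodule.range_subtype]

theorem linearIndependent_finBasis [FiniteDimensional ℂ V] (N : Submodule ℂ V) :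
    LinearIndependent ℂ fun i => (finBasis ℂ N i : V) :=
  (finBasis ℂ N).linearIndependent.map' N.subtype N.ker_subtype

theorem exists_basis_sum {I J K : Type*} {f : I → V} {g : J → V} {h : K → V}
    (hf : LinearIndependent ℂ f) (hg : LinearIndependent ℂ g) (hh : LinearIndependent ℂ h)
    (hgh : Disjoint (Submodule.span ℂ (Set.range g)) (Submodule.span ℂ (Set.range h)))
    (hfgh : IsCompl (Submodule.span ℂ (Set.range f))
      (Submodule.span ℂ (Set.range g) ⊔ Submodule.span ℂ (Set.range h))) :
    ∃ b : Basis (I ⊕ J ⊕ K) ℂ V, ⇑b = Sum.elim f (Sum.elim g h) := by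
  have hs : Submodule.span ℂ (Set.range (Sum.elim g h)) =
      Submodule.span ℂ (Set.range g) ⊔ Submodule.span ℂ (Set.range h) := by
    rw [Set.Sum.elim_range, Submodule.span_union]
  refine ⟨Basis.mk (hf.sum_type (hg.sum_type hh hgh) (by rw [hs]; exact hfgh.disjoint)) ?_,
    Basis.coe_mk _ _⟩
  rw [Set.Sum.elim_range, Submodule.span_union, hs, hfgh.sup_eq_top]

theorem nonempty_canonicalBasisPair [FiniteDimensional ℂ V] [FiniteDimensional ℂ W]
    (P : Submodule ℂ (V × W)) : Nonempty (CanonicalBasisPair P) := by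
  obtain ⟨U, hU⟩ := Submodule.exists_isCompl (relDom P)
  obtain ⟨C₀, hC₀⟩ := Submodule.exists_isCompl (relKer P)
  have hCK : Disjoint (C₀ ⊓ relDom P) (relKer P) := hC₀.symm.disjoint.mono_left inf_le_left
  have hCKD : C₀ ⊓ relDom P ⊔ relKer P = relDom P := by
    rw [sup_comm, ← sup_inf_assoc_of_le C₀ (relKer_le_relDom P), hC₀.sup_eq_top, top_inf_eq]
  set C := C₀ ⊓ relDom P with hC
  obtain ⟨γ, hγ⟩ : ∃ γ : C →ₗ[ℂ] W, ∀ u : C, ((u : V), γ u) ∈ P := by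
    choose G hG using fun j : Fin (finrank ℂ C) => mem_relDom.1 (finBasis ℂ C j).2.2
    refine ⟨(finBasis ℂ C).constr ℂ G, fun u => ?_⟩
    have : (⊤ : Submodule ℂ C) ≤ P.comap (C.subtype.prod ((finBasis ℂ C).constr ℂ G)) := by
      rw [← (finBasis ℂ C).span_eq, Submodule.span_le]
      rintro _ ⟨j, rfl⟩
      simpa using hG j
    exact this Submodule.mem_top
  have hγ0 : ∀ u : C, γ u ∈ relIndef P → u = 0 := fun u hu => by
    refine Subtype.ext (Submodule.disjoint_def.1 hCK u u.2 ?_)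
    rw [mem_relKer]
    simpa using P.sub_mem (hγ u) (mem_relIndef.1 hu)
  have hγker : LinearMap.ker γ = ⊥ := by
    rw [LinearMap.ker_eq_bot']
    exact fun u hu => hγ0 u (hu ▸ Submodule.zero_mem _)
  have hdisj : Disjoint (relIndef P) (LinearMap.range γ) := by
    rw [Submodule.disjoint_def]
    rintro _ hw ⟨u, rfl⟩
    rw [hγ0 u hw, map_zero]
  obtain ⟨H, hH⟩ := Submodule.exists_isCompl (relIndef P ⊔ LinearMap.range γ)
  have hspanγ : Submodule.span ℂ (Set.range fun j => γ (finBasis ℂ C j)) =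
      LinearMap.range γ := by
    have h : (Set.range fun j => γ (finBasis ℂ C j)) = γ '' Set.range (finBasis ℂ C) := by
      rw [← Set.range_comp]
      rfl
    rw [h, Submodule.span_image, Basis.span_eq, LinearMap.range_eq_map]
  obtain ⟨bV, hbV⟩ := exists_basis_sum (linearIndependent_finBasis U)
    (linearIndependent_finBasis C) (linearIndependent_finBasis (relKer P))
    (by rwa [span_range_finBasis, span_range_finBasis])
    (by rw [span_range_finBasis, span_range_finBasis, span_range_finBasis, hCKD]; exact hU.symm)
  obtain ⟨bW, hbW⟩ := exists_basis_sum (linearIndependent_finBasis (relIndef P))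
    ((finBasis ℂ C).linearIndependent.map' γ hγker) (linearIndependent_finBasis H)
    (by
      rw [span_range_finBasis]
      change Disjoint (Submodule.span ℂ (Set.range fun j => γ (finBasis ℂ C j))) H
      rw [hspanγ]
      exact hH.disjoint.mono_left le_sup_right)
    (by
      rw [span_range_finBasis, span_range_finBasis]
      change IsCompl _ (Submodule.span ℂ (Set.range fun j => γ (finBasis ℂ C j)) ⊔ H)
      rw [hspanγ]
      exact ⟨hdisj.disjoint_sup_right_of_disjoint_sup_left hH.disjoint,
        codisjoint_iff.2 (by rw [← sup_assoc, hH.sup_eq_top])⟩)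
  refine ⟨⟨_, _, _, _, _, bV, bW, le_antisymm ?_ ?_⟩⟩
  · set S := Submodule.span ℂ (Set.range (fun i => ((0 : V), bW (Sum.inl i))) ∪
      Set.range (fun j => (bV (Sum.inr (Sum.inl j)), bW (Sum.inr (Sum.inl j)))) ∪
      Set.range (fun l => (bV (Sum.inr (Sum.inr l)), (0 : W)))) with hS
    have hF : relIndef P ≤ S.comap (LinearMap.inr ℂ V W) := by
      rw [← span_range_finBasis (relIndef P), Submodule.span_le]
      rintro _ ⟨i, rfl⟩
      exact Submodule.subset_span (Or.inl (Or.inl ⟨i, by simp [hbW]⟩))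
    have hG : (⊤ : Submodule ℂ C) ≤ S.comap (C.subtype.prod γ) := by
      rw [← (finBasis ℂ C).span_eq, Submodule.span_le]
      rintro _ ⟨j, rfl⟩
      exact Submodule.subset_span (Or.inl (Or.inr ⟨j, by simp [hbV, hbW]⟩))
    have hK : relKer P ≤ S.comap (LinearMap.inl ℂ V W) := by
      rw [← span_range_finBasis (relKer P), Submodule.span_le]
      rintro _ ⟨l, rfl⟩
      exact Submodule.subset_span (Or.inr ⟨l, by simp [hbV]⟩)
    rintro ⟨v, w⟩ hp
    obtain ⟨u, hu, k, hk, rfl⟩ := Submodule.mem_sup.1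
      (hCKD.symm ▸ mem_relDom.2 ⟨w, hp⟩ : v ∈ C ⊔ relKer P)
    have hw : w - γ ⟨u, hu⟩ ∈ relIndef P := by
      have := P.sub_mem (P.sub_mem hp (hγ ⟨u, hu⟩)) (mem_relKer.1 hk)
      rw [mem_relIndef]
      simpa using this
    have := S.add_mem (S.add_mem (hF hw) (hG (Submodule.mem_top (x := ⟨u, hu⟩)))) (hK hk)
    simpa using this
  · rw [Submodule.span_le]
    rintro _ ((⟨i, rfl⟩ | ⟨j, rfl⟩) | ⟨l, rfl⟩)
    · simpa [hbW] using mem_relIndef.1 (finBasis ℂ (relIndef P) i).2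
    · simpa [hbV, hbW] using hγ (finBasis ℂ C j)
    · simpa [hbV] using mem_relKer.1 (finBasis ℂ (relKer P) l).2

variable {P : Submodule ℂ (V × W)} (c : CanonicalBasisPair P)

theorem _root_.CanonicalBasisPair.finrank_left : finrank ℂ V = c.α + c.β + c.γ := by
  rw [finrank_eq_card_basis c.bV]
  simp [add_assoc]

theorem _root_.CanonicalBasisPair.finrank_relation : finrank ℂ P = c.μ + c.β + c.γ := by
  have hli : LinearIndependent ℂ (Sum.elim (Sum.elim
      (fun i : Fin c.μ => ((0 : V), c.bW (Sum.inl i)))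
      (fun j : Fin c.β => (c.bV (Sum.inr (Sum.inl j)), c.bW (Sum.inr (Sum.inl j)))))
      (fun l : Fin c.γ => (c.bV (Sum.inr (Sum.inr l)), (0 : W)))) := by
    rw [Fintype.linearIndependent_iff]
    intro g hg
    simp only [Fintype.sum_sum_type, Sum.elim_inl, Sum.elim_inr] at hg
    have h1 := congrArg Prod.fst hg
    have h2 := congrArg Prod.snd hg
    simp only [Prod.fst_add, Prod.snd_add, Prod.fst_sum, Prod.snd_sum, Prod.smul_fst,
      Prod.smul_snd, smul_zero, Finset.sum_const_zero, zero_add, add_zero, Prod.fst_zero,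
      Prod.snd_zero] at h1 h2
    have hV := Fintype.linearIndependent_iff.1 c.bV.linearIndependent
      (Sum.elim 0 (Sum.elim (fun j => g (Sum.inl (Sum.inr j))) fun l => g (Sum.inr l)))
      (by simpa [Fintype.sum_sum_type] using h1)
    have hW := Fintype.linearIndependent_iff.1 c.bW.linearIndependent
      (Sum.elim (fun i => g (Sum.inl (Sum.inl i)))
        (Sum.elim (fun j => g (Sum.inl (Sum.inr j))) 0))
      (by simpa [Fintype.sum_sum_type] using h2)
    rintro ((i | j) | l)
    · exact hW (Sum.inl i)
    · exact hW (Sum.inr (Sum.inl j))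
    · exact hV (Sum.inr (Sum.inr l))
  have h := finrank_span_eq_card hli
  rw [Set.Sum.elim_range, Set.Sum.elim_range, ← c.hspan] at h
  rw [h]
  simp

end Canonical

section Operator

theorem ι_mul_contract_ι_mul {φ : Dual ℂ V} {u : V} (v : V) (h : φ u = 0)
    (x : ExteriorAlgebra ℂ V) :
    ι ℂ v * contract φ (ι ℂ u * x) = ι ℂ u * (ι ℂ v * contract φ x) := by
  rw [contract_ι_mul, h, zero_smul, zero_sub, mul_neg, ι_mul_ι_mul_comm, neg_neg]

theorem ι_mul_contract_contract {φ ψ : Dual ℂ V} {v : V} (h : ψ v = 0)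
    (x : ExteriorAlgebra ℂ V) :
    ι ℂ v * contract φ (contract ψ x) = contract ψ (ι ℂ v * contract φ x) := by
  rw [contract_ι_mul, h, zero_smul, zero_sub, contract_comm ψ φ, mul_neg, neg_neg]

/-- An operator projecting onto the multiples of the product of the `b i`, `i ∈ s`. -/
structure IsProjector {I : Type*} (b : Basis I ℂ V) (s : Finset I)
    (E : ExteriorAlgebra ℂ V →ₗ[ℂ] ExteriorAlgebra ℂ V) : Prop where
  ι_mul_eq_zero : ∀ i ∈ s, ∀ x, ι ℂ (b i) * E x = 0
  contract_eq_zero : ∀ i ∈ s, ∀ x, E (contract (b.coord i) x) = 0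
  map_ι_mul : ∀ i ∉ s, ∀ x, E (ι ℂ (b i) * x) = ι ℂ (b i) * E x
  map_contract : ∀ i ∉ s, ∀ x, E (contract (b.coord i) x) = contract (b.coord i) (E x)
  eq_self : ∀ x, (∀ i ∈ s, ι ℂ (b i) * x = 0) → E x = x
  mem : ∀ k, ∀ x ∈ ⋀[ℂ]^k V, E x ∈ ⋀[ℂ]^k V

theorem exists_isProjector {I : Type*} (b : Basis I ℂ V) (s : Finset I) :
    ∃ E, IsProjector b s E := by
  classical
  induction s using Finset.induction_on with
  | empty =>
    exact ⟨LinearMap.id, by simp, by simp, fun _ _ _ => rfl, fun _ _ _ => rfl,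
      fun _ _ => rfl, fun _ _ h => h⟩
  | insert i s hi ih =>
    obtain ⟨E, hE⟩ := ih
    refine ⟨E ∘ₗ LinearMap.mulLeft ℂ (ι ℂ (b i)) ∘ₗ contract (b.coord i), ?_, ?_, ?_, ?_, ?_, ?_⟩
    all_goals simp only [LinearMap.comp_apply, LinearMap.mulLeft_apply]
    · intro j hj x
      rcases Finset.mem_insert.1 hj with rfl | hj
      · rw [← hE.map_ι_mul _ hi, ι_mul_ι_mul_self, map_zero]
      · exact hE.ι_mul_eq_zero j hj _
    · intro j hj x
      rcases eq_or_ne j i with rfl | hji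
      · rw [contract_contract_self, mul_zero, map_zero]
      · rw [ι_mul_contract_contract (coord_apply_ne b hji),
          hE.contract_eq_zero j (Finset.mem_of_mem_insert_of_ne hj hji)]
    · intro j hj x
      rw [Finset.mem_insert, not_or] at hj
      rw [ι_mul_contract_ι_mul _ (coord_apply_ne b (Ne.symm hj.1)), hE.map_ι_mul j hj.2]
    · intro j hj x
      rw [Finset.mem_insert, not_or] at hj
      rw [ι_mul_contract_contract (coord_apply_ne b hj.1), hE.map_contract j hj.2]
    · intro x hx
      rw [← eq_ι_mul_of_ι_mul_eq_zero (coord_apply_self b i) (hx i (Finset.mem_insert_self i s))]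
      exact hE.eq_self x fun j hj => hx j (Finset.mem_insert_of_mem hj)
    · intro k x hx
      rcases k with _ | k
      · rw [contract_eq_zero_of_mem_zero _ hx, mul_zero, map_zero]
        exact Submodule.zero_mem _
      · exact hE.mem _ _ (ι_mul_mem _ (contract_mem _ hx))

theorem ιMulti_ne_zero {I : Type*} (b : Basis I ℂ V) {k : ℕ} (x : Fin k → I)
    (hx : Function.Injective x) : ExteriorAlgebra.ιMulti ℂ k (fun i => b (x i)) ≠ 0 := by
  induction k with
  | zero => simp [ExteriorAlgebra.ιMulti_zero_apply]
  | succ k ih =>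
    intro h
    refine ih (fun i => x i.succ) (hx.comp (Fin.succ_injective k)) ?_
    have h1 : ExteriorAlgebra.ιMulti ℂ (k + 1) (fun i => b (x i)) =
        ι ℂ (b (x 0)) * ExteriorAlgebra.ιMulti ℂ k (fun i => b (x i.succ)) := by
      rw [ι_mul_ιMulti]
      congr 1
      exact (Fin.cons_self_tail fun i => b (x i)).symm
    have h2 := congrArg (contract (b.coord (x 0))) (h1.symm.trans h)
    rwa [contract_ι_mul, coord_apply_self, one_smul, contract_ιMulti_eq_zero _ _ fun i =>
      coord_apply_ne b fun h => Fin.succ_ne_zero i (hx h.symm), mul_zero, sub_zero,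
      map_zero] at h2

variable {P : Submodule ℂ (V × W)} (c : CanonicalBasisPair P)

/-- The linear map matching the two bases of a canonical basis pair. -/
def transfer (h : c.α = c.μ) : V →ₗ[ℂ] W :=
  c.bV.constr ℂ (Sum.elim (fun i => c.bW (Sum.inl (Fin.cast h i)))
    (Sum.elim (fun j => c.bW (Sum.inr (Sum.inl j))) 0))

theorem transfer_inl (h : c.α = c.μ) (i : Fin c.α) :
    transfer c h (c.bV (Sum.inl i)) = c.bW (Sum.inl (Fin.cast h i)) := by
  simp [transfer]

theorem transfer_inr_inl (h : c.α = c.μ) (j : Fin c.β) :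
    transfer c h (c.bV (Sum.inr (Sum.inl j))) = c.bW (Sum.inr (Sum.inl j)) := by
  simp [transfer]

theorem transfer_inr_inr (h : c.α = c.μ) (l : Fin c.γ) :
    transfer c h (c.bV (Sum.inr (Sum.inr l))) = 0 := by
  simp [transfer]

/-- The operator `λ(P)`: it preserves degrees, is a spinor of `P`, and takes the prescribed values
on the monomials of the basis `c.bV`. -/
structure IsCanonicalOperator (h : c.α = c.μ)
    (L : ExteriorAlgebra ℂ V →ₗ[ℂ] ExteriorAlgebra ℂ W) : Prop where
  isSpinor : IsSpinor P L
  mem : ∀ k, ∀ x ∈ ⋀[ℂ]^k V, L x ∈ ⋀[ℂ]^k W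
  eq_zero : ∀ (k : ℕ) (x : Fin k → (Fin c.α ⊕ Fin c.β ⊕ Fin c.γ)) (i : Fin c.α),
    Sum.inl i ∉ Set.range x → L (ExteriorAlgebra.ιMulti ℂ k fun i => c.bV (x i)) = 0
  eq_transfer : ∀ (k : ℕ) (x : Fin k → (Fin c.α ⊕ Fin c.β ⊕ Fin c.γ)),
    (∀ i : Fin c.α, Sum.inl i ∈ Set.range x) →
      L (ExteriorAlgebra.ιMulti ℂ k fun i => c.bV (x i)) =
        ExteriorAlgebra.ιMulti ℂ k fun i => transfer c h (c.bV (x i))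

theorem exists_isCanonicalOperator (h : c.α = c.μ) : ∃ L, IsCanonicalOperator c h L := by
  classical
  obtain ⟨E, hE⟩ := exists_isProjector c.bV (Finset.univ.image (Sum.inl : Fin c.α → _))
  have hl : ∀ i : Fin c.α, Sum.inl i ∈ Finset.univ.image
      (Sum.inl : Fin c.α → Fin c.α ⊕ Fin c.β ⊕ Fin c.γ) := by simp
  have hr : ∀ j : Fin c.β ⊕ Fin c.γ, Sum.inr j ∉ Finset.univ.image
      (Sum.inl : Fin c.α → Fin c.α ⊕ Fin c.β ⊕ Fin c.γ) := by simp
  refine ⟨(ExteriorAlgebra.map (transfer c h)).toLinearMap ∘ₗ E, ⟨?_, ?_⟩, ?_, ?_, ?_⟩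
  all_goals simp only [LinearMap.comp_apply, AlgHom.toLinearMap_apply]
  · intro p hp x
    rw [c.hspan] at hp
    induction hp using Submodule.span_induction with
    | mem p hp =>
      rcases hp with (⟨i, rfl⟩ | ⟨j, rfl⟩) | ⟨l, rfl⟩
      · have h1 := congrArg (ExteriorAlgebra.map (transfer c h))
          (hE.ι_mul_eq_zero _ (hl (Fin.cast h.symm i)) x)
        rw [map_mul, ExteriorAlgebra.map_apply_ι, transfer_inl, map_zero] at h1
        rw [map_zero, zero_mul, map_zero, map_zero]
        exact h1.symm
      · rw [hE.map_ι_mul _ (hr _), map_mul, ExteriorAlgebra.map_apply_ι, transfer_inr_inl]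
      · rw [hE.map_ι_mul _ (hr _), map_mul, ExteriorAlgebra.map_apply_ι, transfer_inr_inr]
    | zero => simp
    | add p q _ _ hp hq => simp only [Prod.fst_add, Prod.snd_add, map_add, add_mul, hp, hq]
    | smul a p _ hp =>
      simp only [Prod.smul_fst, Prod.smul_snd, map_smul, smul_mul_assoc, hp]
  · intro φ ψ hφψ x
    have hF : ∀ i, ψ (c.bW (Sum.inl i)) = 0 := fun i => by
      have := hφψ (0, c.bW (Sum.inl i))
        (c.hspan.ge (Submodule.subset_span (Or.inl (Or.inl ⟨i, rfl⟩))))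
      simpa using this.symm
    have hG : ∀ j, φ (c.bV (Sum.inr (Sum.inl j))) = ψ (c.bW (Sum.inr (Sum.inl j))) := fun j =>
      hφψ (c.bV (Sum.inr (Sum.inl j)), c.bW (Sum.inr (Sum.inl j)))
        (c.hspan.ge (Submodule.subset_span (Or.inl (Or.inr ⟨j, rfl⟩))))
    have hH : ∀ l, φ (c.bV (Sum.inr (Sum.inr l))) = 0 := fun l => by
      have := hφψ (c.bV (Sum.inr (Sum.inr l)), 0)
        (c.hspan.ge (Submodule.subset_span (Or.inr ⟨l, rfl⟩)))
      simpa using this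
    have hψ : ψ ∘ₗ transfer c h = ∑ j, φ (c.bV (Sum.inr j)) • c.bV.coord (Sum.inr j) := by
      refine c.bV.ext ?_
      rintro (i | j | l)
      · simp [transfer_inl, hF]
      · simp [transfer_inr_inl, hG, Finsupp.single_apply]
      · simp [transfer_inr_inr, hH]
    have hφ : φ = ∑ i, φ (c.bV (Sum.inl i)) • c.bV.coord (Sum.inl i) + ψ ∘ₗ transfer c h := by
      rw [hψ]
      refine c.bV.ext ?_
      rintro (i | j | l) <;> simp [Finsupp.single_apply]
    rw [← map_contract, hφ, contract_add]
    rw [LinearMap.add_apply, map_add, map_add, hψ]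
    simp only [contract_sum, contract_smul, LinearMap.sum_apply, LinearMap.smul_apply, map_sum,
      map_smul]
    simp only [hE.contract_eq_zero _ (hl _), hE.map_contract _ (hr _)]
    simp
  · exact fun k x hx => map_mem _ (hE.mem k x hx)
  · intro k x i hi
    rw [eq_contract_of_contract_eq_zero (coord_apply_self c.bV (Sum.inl i))
      (contract_ιMulti_eq_zero _ _ fun p => coord_apply_ne c.bV fun h => hi ⟨p, h.symm⟩),
      hE.contract_eq_zero _ (hl i), map_zero]
  · intro k x hx
    rw [hE.eq_self]
    · rw [ExteriorAlgebra.map_apply_ιMulti]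
      rfl
    · intro i hi
      obtain ⟨i, -, rfl⟩ := Finset.mem_image.1 hi
      obtain ⟨p, hp⟩ := hx i
      exact ι_mul_ιMulti_eq_zero _ (i := p) (by rw [hp])

end Operator

section Component

variable {P : Submodule ℂ (V × W)} (c : CanonicalBasisPair P)

theorem _root_.CanonicalBasisPair.α_eq_μ [FiniteDimensional ℂ V]
    (hP : finrank ℂ P = finrank ℂ V) : c.α = c.μ := by
  have h1 := c.finrank_left
  have h2 := c.finrank_relation
  omega

/-- The index tuple of `goodTupleV c s`. -/
def goodIndex (s : Finset (Fin c.β)) : Fin (c.α + s.card) → Fin c.α ⊕ Fin c.β ⊕ Fin c.γ :=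
  Fin.addCases Sum.inl fun j => Sum.inr (Sum.inl ((s.orderIsoOfFin rfl j : s) : Fin c.β))

theorem goodTupleV_apply (s : Finset (Fin c.β)) (p : Fin (c.α + s.card)) :
    goodTupleV c s p = c.bV (goodIndex c s p) := by
  refine Fin.addCases (fun i => ?_) (fun j => ?_) p <;> simp [goodTupleV, goodIndex]

theorem goodTupleW_apply (h : c.α = c.μ) (s : Finset (Fin c.β)) (p : Fin (c.α + s.card))
    (h' : c.α + s.card = c.μ + s.card) :
    goodTupleW c s (Fin.cast h' p) = transfer c h (c.bV (goodIndex c s p)) := by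
  refine Fin.addCases (fun i => ?_) (fun j => ?_) p
  · have : Fin.cast h' (Fin.castAdd s.card i) = Fin.castAdd s.card (Fin.cast h i) := rfl
    rw [this]
    simp [goodTupleW, goodIndex, transfer_inl]
  · have : Fin.cast h' (Fin.natAdd c.α j) = Fin.natAdd c.μ j := by
      ext
      simp
    rw [this]
    simp [goodTupleW, goodIndex, transfer_inr_inl]

theorem goodIndex_injective (s : Finset (Fin c.β)) : Function.Injective (goodIndex c s) := by
  intro p q
  refine Fin.addCases (fun i => ?_) (fun j => ?_) p <;>
    refine Fin.addCases (fun i' => ?_) (fun j' => ?_) q <;>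
    simp [goodIndex]

theorem inl_mem_range_goodIndex (s : Finset (Fin c.β)) (i : Fin c.α) :
    Sum.inl i ∈ Set.range (goodIndex c s) :=
  ⟨Fin.castAdd s.card i, by simp [goodIndex]⟩

theorem inr_inl_mem_range_goodIndex (s : Finset (Fin c.β)) (j : Fin c.β) :
    Sum.inr (Sum.inl j) ∈ Set.range (goodIndex c s) ↔ j ∈ s := by
  constructor
  · rintro ⟨p, hp⟩
    revert hp
    refine Fin.addCases (fun i => ?_) (fun j' => ?_) p
    · simp [goodIndex]
    · simp only [goodIndex, Fin.addCases_right, Sum.inr.injEq, Sum.inl.injEq]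
      rintro rfl
      exact (s.orderIsoOfFin rfl j').2
  · intro hj
    refine ⟨Fin.natAdd c.α ((s.orderIsoOfFin rfl).symm ⟨j, hj⟩), ?_⟩
    simp only [goodIndex, Fin.addCases_right, OrderIso.apply_symm_apply]

theorem inr_inr_notMem_range_goodIndex (s : Finset (Fin c.β)) (l : Fin c.γ) :
    Sum.inr (Sum.inr l) ∉ Set.range (goodIndex c s) := by
  rintro ⟨p, hp⟩
  revert hp
  refine Fin.addCases (fun i => ?_) (fun j => ?_) p <;> simp [goodIndex]

variable {c} {h : c.α = c.μ} {L : ExteriorAlgebra ℂ V →ₗ[ℂ] ExteriorAlgebra ℂ W} {m : ℕ}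

theorem IsCanonicalOperator.ne_zero (hL : IsCanonicalOperator c h L) : L ≠ 0 := by
  intro h0
  refine ιMulti_ne_zero c.bW (fun i : Fin c.α => Sum.inl (Fin.cast h i))
    (Sum.inl_injective.comp (Fin.cast_injective h)) ?_
  have := hL.eq_transfer c.α Sum.inl fun i => ⟨i, rfl⟩
  simpa [h0, transfer_inl] using this.symm

theorem IsCanonicalOperator.isLambdaM (hL : IsCanonicalOperator c h L) (m : ℕ) :
    IsLambdaM c m (L.restrict (hL.mem m)) := by
  refine ⟨fun s h1 h2 => Subtype.ext ?_, fun x hx => Subtype.ext ?_⟩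
  · change L (ExteriorAlgebra.ιMulti ℂ m _) = ExteriorAlgebra.ιMulti ℂ m _
    subst h1
    have h3 : goodTupleV c s ∘ Fin.cast rfl = fun p => c.bV (goodIndex c s p) :=
      funext fun p => goodTupleV_apply c s p
    have h4 : goodTupleW c s ∘ Fin.cast h2.symm = fun p => transfer c h (c.bV (goodIndex c s p)) :=
      funext fun p => goodTupleW_apply c h s p h2.symm
    rw [h3, h4]
    exact hL.eq_transfer _ _ (inl_mem_range_goodIndex c s)
  · change L (ExteriorAlgebra.ιMulti ℂ m _) = 0
    by_cases hf : ∃ i : Fin c.α, Sum.inl i ∉ Set.range x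
    · obtain ⟨i, hi⟩ := hf
      exact hL.eq_zero m x i hi
    · obtain ⟨l, p, hp⟩ := hx.resolve_left hf
      push Not at hf
      rw [hL.eq_transfer m x hf]
      exact AlternatingMap.map_coord_zero _ p (by rw [hp, transfer_inr_inr])

theorem exists_perm_eq_comp {I : Type*} {k : ℕ} {x y : Fin k → I} (hx : Function.Injective x)
    (hy : Function.Injective y) (hxy : Set.range x = Set.range y) :
    ∃ σ : Equiv.Perm (Fin k), x = y ∘ σ := by
  refine ⟨(Equiv.ofInjective x hx).trans
    ((Equiv.setCongr hxy).trans (Equiv.ofInjective y hy).symm), funext fun i => ?_⟩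
  simp only [Function.comp_apply, Equiv.trans_apply]
  rw [Equiv.apply_ofInjective_symm hy]
  rfl

theorem _root_.IsLambdaM.unique {A B : (⋀[ℂ]^m V) →ₗ[ℂ] (⋀[ℂ]^m W)} (h : c.α = c.μ)
    (hA : IsLambdaM c m A) (hB : IsLambdaM c m B) : A = B := by
  classical
  refine exteriorPower.linearMap_ext (Basis.ext_alternating c.bV fun x hx => ?_)
  change A (ιMultiP m fun i => c.bV (x i)) = B (ιMultiP m fun i => c.bV (x i))
  by_cases hbad : (∃ i : Fin c.α, Sum.inl i ∉ Set.range x) ∨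
      ∃ l : Fin c.γ, Sum.inr (Sum.inr l) ∈ Set.range x
  · rw [hA.2 x hbad, hB.2 x hbad]
  push Not at hbad
  set s : Finset (Fin c.β) := Finset.univ.filter fun j => Sum.inr (Sum.inl j) ∈ Set.range x with hs
  have hrange : Set.range x = Set.range (goodIndex c s) := by
    ext (i | j | l)
    · exact iff_of_true (hbad.1 i) (inl_mem_range_goodIndex c s i)
    · rw [inr_inl_mem_range_goodIndex, hs, Finset.mem_filter]
      simp only [Finset.mem_univ, true_and]
    · exact iff_of_false (hbad.2 l) (inr_inr_notMem_range_goodIndex c s l)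
  have hm : c.α + s.card = m := by
    have h1 := Set.ncard_range_of_injective hx
    have h2 := Set.ncard_range_of_injective (goodIndex_injective c s)
    rw [hrange, h2] at h1
    simpa using h1
  obtain ⟨σ, hσ⟩ := exists_perm_eq_comp hx
    ((goodIndex_injective c s).comp (Fin.cast_injective hm.symm))
    (hrange.trans ((finCongr hm.symm).surjective.range_comp _).symm)
  have hgood := (hA.1 s hm (h ▸ hm)).trans (hB.1 s hm (h ▸ hm)).symm
  have hx' : (fun i => c.bV (x i)) = (goodTupleV c s ∘ Fin.cast hm.symm) ∘ σ := by
    funext i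
    simp [hσ, goodTupleV_apply]
  have hσV : ιMultiP m (fun i => c.bV (x i)) =
      Equiv.Perm.sign σ • ιMultiP m (goodTupleV c s ∘ Fin.cast hm.symm) := by
    rw [hx']
    exact (exteriorPower.ιMulti ℂ m).map_perm _ σ
  rw [hσV, Units.smul_def, map_zsmul, map_zsmul, hgood]

/-- Every version of `λ^m(P)` is the degree `m` component of a spinor of `P`. -/
theorem _root_.IsLambdaM.exists_isSpinor [FiniteDimensional ℂ V] (hP : finrank ℂ P = finrank ℂ V)
    {A : (⋀[ℂ]^m V) →ₗ[ℂ] (⋀[ℂ]^m W)} (hA : IsLambdaM c m A) :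
    ∃ L, IsSpinor P L ∧ L ≠ 0 ∧ ∀ x : ⋀[ℂ]^m V, L x = A x := by
  have h := c.α_eq_μ hP
  obtain ⟨L, hL⟩ := exists_isCanonicalOperator c h
  refine ⟨L, hL.isSpinor, hL.ne_zero, fun x => ?_⟩
  rw [hA.unique h (hL.isLambdaM m)]
  rfl

theorem exists_isLambdaM [FiniteDimensional ℂ V] [FiniteDimensional ℂ W]
    {P : Submodule ℂ (V × W)} (hP : finrank ℂ P = finrank ℂ V) (m : ℕ) :
    ∃ (c : CanonicalBasisPair P) (A : (⋀[ℂ]^m V) →ₗ[ℂ] (⋀[ℂ]^m W)), IsLambdaM c m A := by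
  obtain ⟨c⟩ := nonempty_canonicalBasisPair P
  obtain ⟨L, hL⟩ := exists_isCanonicalOperator c (c.α_eq_μ hP)
  exact ⟨c, _, hL.isLambdaM m⟩

end Component

section WeakHinge

variable [FiniteDimensional ℂ V] {m : ℕ}

theorem IsSpinor.map_eq_zero_of_isLambdaM [FiniteDimensional ℂ W] {P : Submodule ℂ (V × W)}
    (hP : finrank ℂ P = finrank ℂ V) {L : ExteriorAlgebra ℂ V →ₗ[ℂ] ExteriorAlgebra ℂ W}
    (hL : IsSpinor P L)
    (h0 : ∀ (c : CanonicalBasisPair P) (A : (⋀[ℂ]^m V) →ₗ[ℂ] (⋀[ℂ]^m W)),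
      IsLambdaM c m A → A = 0) (x : ⋀[ℂ]^m V) : L x = 0 := by
  obtain ⟨c, A, hA⟩ := exists_isLambdaM hP m
  obtain ⟨M, hM, hM0, hMA⟩ := hA.exists_isSpinor hP
  obtain ⟨a, rfl⟩ := hM.exists_eq_smul hL hM0
  simp [hMA x, h0 c A hA]

theorem exists_isSpinor_ne_zero [FiniteDimensional ℂ W] {P : Submodule ℂ (V × W)}
    (hP : finrank ℂ P = finrank ℂ V) (m : ℕ) :
    ∃ (L : ExteriorAlgebra ℂ V →ₗ[ℂ] ExteriorAlgebra ℂ W) (A : (⋀[ℂ]^m V) →ₗ[ℂ] (⋀[ℂ]^m W)),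
      IsSpinor P L ∧ L ≠ 0 ∧ ∀ x : ⋀[ℂ]^m V, L x = A x := by
  obtain ⟨c, A, hA⟩ := exists_isLambdaM hP m
  obtain ⟨L, hL, hL0, hLA⟩ := hA.exists_isSpinor hP
  exact ⟨L, A, hL, hL0, hLA⟩

variable {s : ℕ} {R : Fin s → Submodule ℂ (V × V)} {A : (⋀[ℂ]^m V) →ₗ[ℂ] (⋀[ℂ]^m V)}

theorem _root_.IsLambdaWeak.exists_isSpinor (hR : IsWeakHinge R) (hA : IsLambdaWeak R m A)
    (h0 : A ≠ 0) : ∃ j L, IsSpinor (R j) L ∧ ∀ x : ⋀[ℂ]^m V, L x = A x := by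
  rcases hA with ⟨j, c, hA, -⟩ | ⟨-, hA⟩
  · obtain ⟨L, hL, -, hLA⟩ := hA.exists_isSpinor (hR.dim_eq j)
    exact ⟨j, L, hL, hLA⟩
  · exact absurd hA h0

theorem _root_.IsLambdaWeak.exists_eq_smul (hR : IsWeakHinge R) (hA : IsLambdaWeak R m A)
    {j : Fin s} {L : ExteriorAlgebra ℂ V →ₗ[ℂ] ExteriorAlgebra ℂ V} (hL : IsSpinor (R j) L)
    {x : ExteriorAlgebra ℂ V} (hx : x ∈ ⋀[ℂ]^m V) (hLx : L x ≠ 0) :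
    ∃ a : ℂ, a ≠ 0 ∧ ∀ z : ⋀[ℂ]^m V, (A z : ExteriorAlgebra ℂ V) = a • L z := by
  have h0 : A ≠ 0 := by
    rcases hA with ⟨_, _, _, h⟩ | ⟨h, -⟩
    · exact h
    · exact absurd (hL.map_eq_zero_of_isLambdaM (hR.dim_eq j) (h j) ⟨x, hx⟩) hLx
  obtain ⟨j', L', hL', hLA⟩ := hA.exists_isSpinor hR h0
  obtain ⟨y, hy⟩ : ∃ y, A y ≠ 0 := by
    by_contra! h
    exact h0 (LinearMap.ext h)
  obtain ⟨a, ha, haL⟩ := hR.exists_eq_smul hL hL' hx hLx y.2 (by simpa [hLA] using hy)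
  exact ⟨a, ha, fun z => by rw [← hLA z, haL z z.2]⟩

end WeakHinge

end

end LinearRelation

/-- For weak hinges `T`, `R` with product weak hinge `TR` (formed by the products `T_i R_j`
over transversal pairs), one has `λ^m(T) ∘ λ^m(R) = c · λ^m(TR)` for some `c ≠ 0`. -/
theorem lambdaWeak_comp
    {V : Type*} [AddCommGroup V] [Module ℂ V] [FiniteDimensional ℂ V]
    {n s t : ℕ} (hn : finrank ℂ V = n)
    (R : Fin s → Submodule ℂ (V × V)) (hR : IsWeakHinge R)
    (T : Fin t → Submodule ℂ (V × V)) (hT : IsWeakHinge T)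
    {r : ℕ} (S : Fin r → Submodule ℂ (V × V)) (hS : IsWeakHinge S)
    (e : {p : Fin t × Fin s // Transversal (T p.1) (R p.2)} ≃ Fin r)
    (hSe : ∀ p, S (e p) = relComp (T p.1.1) (R p.1.2))
    (m : ℕ) (hm : m ≤ n)
    (LR LT LS : (⋀[ℂ]^m V) →ₗ[ℂ] (⋀[ℂ]^m V))
    (hLR : IsLambdaWeak R m LR) (hLT : IsLambdaWeak T m LT) (hLS : IsLambdaWeak S m LS) :
    ∃ c : ℂ, c ≠ 0 ∧ LT ∘ₗ LR = c • LS := by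
  rcases hLS with ⟨k, c, hLS, hLS0⟩ | ⟨hLS, rfl⟩
  · obtain ⟨⟨⟨i, j⟩, hij⟩, rfl⟩ := e.surjective k
    have hdim := hS.dim_eq (e ⟨(i, j), hij⟩)
    obtain ⟨LA, -, hLA, hLA0, -⟩ := LinearRelation.exists_isSpinor_ne_zero (hT.dim_eq i) m
    obtain ⟨LB, B, hLB, hLB0, hB⟩ := LinearRelation.exists_isSpinor_ne_zero (hR.dim_eq j) m
    obtain ⟨M, hM, hM0, hMS⟩ := hLS.exists_isSpinor hdim
    have hAB := hLA.comp hLB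
    rw [← hSe ⟨(i, j), hij⟩] at hAB
    obtain ⟨d, hd⟩ := hM.exists_eq_smul hAB hM0
    have hd0 : d ≠ 0 := by
      rintro rfl
      exact hLA.comp_ne_zero hLB hij hLA0 hLB0 (by rw [hd, zero_smul])
    have hdS : ∀ x : ⋀[ℂ]^m V, LA (LB x) = d • (LS x : ExteriorAlgebra ℂ V) := fun x => by
      rw [← hMS]
      exact LinearMap.congr_fun hd x
    obtain ⟨y, hy⟩ : ∃ y, LS y ≠ 0 := by
      by_contra! h
      exact hLS0 (LinearMap.ext h)
    have hABy : LA (LB y) ≠ 0 := by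
      rw [hdS]
      exact smul_ne_zero hd0 (by simpa using hy)
    obtain ⟨a, ha, hTa⟩ := hLT.exists_eq_smul hT hLA (B y).2 (hB y ▸ hABy)
    obtain ⟨b, hb, hRb⟩ := hLR.exists_eq_smul hR hLB y.2 fun h => hABy (by rw [h, map_zero])
    refine ⟨a * b * d, mul_ne_zero (mul_ne_zero ha hb) hd0, LinearMap.ext fun x => Subtype.ext ?_⟩
    rw [LinearMap.comp_apply, hTa, hRb, map_smul, hdS, smul_smul, smul_smul]
    rfl
  · refine ⟨1, one_ne_zero, ?_⟩
    rw [smul_zero]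
    rcases eq_or_ne LT 0 with rfl | hT0
    · exact LinearMap.zero_comp _
    rcases eq_or_ne LR 0 with rfl | hR0
    · exact LinearMap.comp_zero _
    obtain ⟨i, LA, hLA, hA⟩ := hLT.exists_isSpinor hT hT0
    obtain ⟨j, LB, hLB, hB⟩ := hLR.exists_isSpinor hR hR0
    refine LinearMap.ext fun x => Subtype.ext ?_
    rw [LinearMap.comp_apply, ← hA, ← hB]
    by_cases hij : Transversal (T i) (R j)
    · have hAB := hLA.comp hLB
      rw [← hSe ⟨(i, j), hij⟩] at hAB
      exact hAB.map_eq_zero_of_isLambdaM (hS.dim_eq _) (hLS _) x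
    · exact LinearMap.congr_fun (hLA.comp_eq_zero hLB hij) (x : ExteriorAlgebra ℂ V)
end
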